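/- arXiv:1205.3127 — 10 statements merged into one kernel-verified Lean document; each statement's English description precedes it below -/
import Mathlib

section
/- (Taylor) The defining ideal of the Rees algebra of a monomial ideal is generated by the Taylor binomials of all lengths: ker φ = span(⋃_{s ≥ 1} J_s). -/
open MvPolynomial

/-- The exponent vector of the gcd of two monomials: the pointwise minimum
of the two exponent vectors. -/
noncomputable def expGcd {σ : Type*} (a b : σ →₀ ℕ) : σ →₀ ℕ := a ⊓ b

/-- A square-free exponent vector: all exponents are `0` or `1`. -/
def SqFreeExp {σ : Type*} (a : σ →₀ ℕ) : Prop := ∀ x, a x ≤ 1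

variable (k : Type*) [Field k] {σ : Type*} {n : ℕ}

/-- The Taylor binomial `T_{α,β} = (f_β / gcd(f_α,f_β)) T_α - (f_α / gcd(f_α,f_β)) T_β`
associated to two sequences `α β : Fin s → Fin n`, where `f_i` is the monomial with
exponent vector `e i`.  It lives in `S = R[T_1,…,T_n]`, realized as
`MvPolynomial (Fin n) (MvPolynomial σ k)`. -/
noncomputable def Tab (e : Fin n → (σ →₀ ℕ)) {s : ℕ} (α β : Fin s → Fin n) :
    MvPolynomial (Fin n) (MvPolynomial σ k) :=
  C (monomial ((∑ i, e (β i)) - expGcd (∑ i, e (α i)) (∑ i, e (β i))) (1 : k)) *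
      (∏ i, X (α i))
  - C (monomial ((∑ i, e (α i)) - expGcd (∑ i, e (α i)) (∑ i, e (β i))) (1 : k)) *
      (∏ i, X (β i))

/-- `J_s`, the set of all Taylor binomials coming from pairs of sequences of length `s`. -/
noncomputable def Jset (e : Fin n → (σ →₀ ℕ)) (s : ℕ) :
    Set (MvPolynomial (Fin n) (MvPolynomial σ k)) :=
  { p | ∃ α β : Fin s → Fin n, p = Tab k e α β }

/-- The map `φ : S = R[T_1,…,T_n] → R[t]` sending `T_i ↦ f_i t`; its kernel is the
defining ideal of the Rees algebra `R[It]`. -/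
noncomputable def reesMap (e : Fin n → (σ →₀ ℕ)) :
    MvPolynomial (Fin n) (MvPolynomial σ k) →ₐ[MvPolynomial σ k]
      Polynomial (MvPolynomial σ k) :=
  aeval fun i => Polynomial.C (monomial (e i) (1 : k)) * Polynomial.X

/-- If a linear map sends a basis into a basis, its kernel lies in any submodule containing
the differences of basis vectors with equal image. -/
theorem LinearMap.ker_le_of_map_basis {K M N ι κ : Type*} [CommRing K] [AddCommGroup M]
    [Module K M] [AddCommGroup N] [Module K N] (b : Module.Basis ι K M) (c : Module.Basis κ K N)
    (f : M →ₗ[K] N) (g : ι → κ) (hf : ∀ i, f (b i) = c (g i)) (W : Submodule K M)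
    (hW : ∀ i j, g i = g j → b i - b j ∈ W) : LinearMap.ker f ≤ W := by
  have hfac : (fun i => W.mkQ (b i)).FactorsThrough g := fun i j h =>
    (Submodule.Quotient.eq W).2 (hW i j h)
  have hcomp : (c.constr K (Function.extend g (fun i => W.mkQ (b i)) 0)) ∘ₗ f = W.mkQ := by
    refine b.ext fun i => ?_
    rw [LinearMap.comp_apply, hf, Module.Basis.constr_basis, hfac.extend_apply]
  intro x hx
  rw [← W.ker_mkQ, ← hcomp, LinearMap.mem_ker, LinearMap.comp_apply, LinearMap.mem_ker.1 hx,
    map_zero]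

/-- Every exponent vector of degree `s` is the exponent vector of a sequence of length `s`. -/
theorem Finsupp.exists_sum_single_eq {ι : Type*} {s : ℕ} {d : ι →₀ ℕ} (hd : d.degree = s) :
    ∃ α : Fin s → ι, ∑ i, Finsupp.single (α i) 1 = d := by
  induction s generalizing d with
  | zero => exact ⟨Fin.elim0, by simpa [eq_comm] using (Finsupp.degree_eq_zero_iff d).1 hd⟩
  | succ s ih =>
    obtain ⟨i, hi⟩ : ∃ i, d i ≠ 0 := by
      by_contra! h
      obtain rfl : d = 0 := Finsupp.ext h
      simp at hd
    have hle : Finsupp.single i 1 ≤ d := Finsupp.single_le_iff.2 (Nat.one_le_iff_ne_zero.2 hi)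
    have hdeg : (d - Finsupp.single i 1).degree = s := by
      have := congrArg Finsupp.degree (add_tsub_cancel_of_le hle)
      rw [map_add, Finsupp.degree_single] at this
      omega
    obtain ⟨α, hα⟩ := ih hdeg
    refine ⟨Fin.cons i α, ?_⟩
    simp [Fin.sum_univ_succ, hα, add_tsub_cancel_of_le hle]

theorem reesMap_monomial (e : Fin n → (σ →₀ ℕ)) (d : Fin n →₀ ℕ) (r : MvPolynomial σ k) :
    reesMap k e (monomial d r) =
      Polynomial.monomial d.degree (r * monomial (d.sum fun i m => m • e i) 1) := by
  rw [reesMap, aeval_monomial, ← Polynomial.C_mul_X_pow_eq_monomial]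
  simp only [mul_pow, Finsupp.prod, Finset.prod_mul_distrib, Finsupp.sum, ← map_pow, ← map_prod,
    Finset.prod_pow_eq_pow_sum, monomial_pow, one_pow, monomial_sum_one, Finsupp.degree_apply,
    Polynomial.algebraMap_eq, map_mul, mul_assoc]

theorem prod_X_eq_monomial {R ι : Type*} [CommSemiring R] {s : ℕ} (α : Fin s → ι) :
    ∏ i, (X (α i) : MvPolynomial ι R) = monomial (∑ i, Finsupp.single (α i) 1) 1 := by
  rw [monomial_sum_one]
  rfl

theorem sum_smul_sum_single (e : Fin n → (σ →₀ ℕ)) {s : ℕ} (α : Fin s → Fin n) :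
    ((∑ i, Finsupp.single (α i) 1 : Fin n →₀ ℕ).sum fun i m => m • e i) = ∑ i, e (α i) := by
  rw [← Finsupp.sum_finsetSum_index (by simp) (by intros; rw [add_smul])]
  simp

theorem Tab_mem_ker (e : Fin n → (σ →₀ ℕ)) {s : ℕ} (α β : Fin s → Fin n) :
    Tab k e α β ∈ RingHom.ker (reesMap k e) := by
  rw [RingHom.mem_ker, Tab, map_sub, prod_X_eq_monomial, prod_X_eq_monomial, C_mul_monomial,
    C_mul_monomial, reesMap_monomial, reesMap_monomial, sum_smul_sum_single, sum_smul_sum_single,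
    sub_eq_zero]
  simp only [mul_one, monomial_mul, expGcd]
  congr 2
  · simp
  · congr 1
    ext x
    simp only [Finsupp.add_apply, Finsupp.tsub_apply, Finsupp.inf_apply]
    omega

theorem monomial_sub_monomial_mem_span_Jset (e : Fin n → (σ →₀ ℕ)) {d d' : Fin n →₀ ℕ}
    {a a' : σ →₀ ℕ} (hd : d.degree = d'.degree)
    (ha : a + (d.sum fun i m => m • e i) = a' + (d'.sum fun i m => m • e i)) :
    monomial d (monomial a (1 : k)) - monomial d' (monomial a' (1 : k)) ∈
      Ideal.span (⋃ s ∈ Set.Ici 1, Jset k e s) := by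
  rcases Nat.eq_zero_or_pos d.degree with h0 | hpos
  · obtain rfl := (Finsupp.degree_eq_zero_iff d).1 h0
    obtain rfl := (Finsupp.degree_eq_zero_iff d').1 (hd ▸ h0)
    obtain rfl : a = a' := by simpa using ha
    simp
  · obtain ⟨s, hs⟩ : ∃ s, d.degree = s := ⟨_, rfl⟩
    obtain ⟨α, rfl⟩ := Finsupp.exists_sum_single_eq hs
    obtain ⟨β, rfl⟩ := Finsupp.exists_sum_single_eq (hd.symm.trans hs)
    rw [sum_smul_sum_single, sum_smul_sum_single] at ha
    have hT : Tab k e α β ∈ Ideal.span (⋃ s ∈ Set.Ici 1, Jset k e s) :=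
      Ideal.subset_span (Set.mem_biUnion (show s ∈ Set.Ici 1 from hs ▸ hpos) ⟨α, β, rfl⟩)
    convert Ideal.mul_mem_left _
      (C (monomial (a - ((∑ i, e (β i)) - expGcd (∑ i, e (α i)) (∑ i, e (β i)))) 1)) hT using 1
    rw [Tab, prod_X_eq_monomial, prod_X_eq_monomial, mul_sub, C_mul_monomial, C_mul_monomial,
      C_mul_monomial, C_mul_monomial]
    simp only [mul_one, monomial_mul, expGcd]
    congr 3 <;> congr 1 <;> ext x <;>
      · have := DFunLike.congr_fun ha x
        simp only [Finsupp.add_apply, Finsupp.tsub_apply, Finsupp.inf_apply] at this ⊢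
        omega

/-- **(Taylor)** The defining ideal of the Rees algebra of a monomial ideal is generated by
the Taylor binomials of all lengths: `ker φ = span (⋃_{s ≥ 1} J_s)`. -/
theorem taylor_kernel_eq_span_Jset
    (e : Fin n → (σ →₀ ℕ)) (hsf : ∀ i, SqFreeExp (e i))
    (hmin : ∀ i j : Fin n, i ≠ j →
      ¬ ((monomial (e i) (1 : k) : MvPolynomial σ k) ∣ monomial (e j) (1 : k))) :
    RingHom.ker (reesMap k e) = Ideal.span (⋃ s ∈ Set.Ici 1, Jset k e s) := by
  apply le_antisymm
  · let b := (basisMonomials σ k).smulTower (basisMonomials (Fin n) (MvPolynomial σ k))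
    let c := (basisMonomials σ k).smulTower (Polynomial.basisMonomials (MvPolynomial σ k))
    have hb : ∀ i, b i = monomial i.2 (monomial i.1 1) := fun i => by
      simp [b, Module.Basis.smulTower_apply, smul_monomial]
    have hc : ∀ i, c i = Polynomial.monomial i.2 (monomial i.1 1) := fun i => by
      simp [c, Module.Basis.smulTower_apply, Polynomial.smul_monomial]
    intro p hp
    refine LinearMap.ker_le_of_map_basis b c ((reesMap k e).toLinearMap.restrictScalars k)
      (fun i => (i.1 + i.2.sum fun j m => m • e j, i.2.degree)) (fun i => ?_)
      ((Ideal.span (⋃ s ∈ Set.Ici 1, Jset k e s)).restrictScalars k) (fun i j hij => ?_) hp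
    · simp [hb, hc, reesMap_monomial, monomial_mul]
    · rw [hb, hb]
      exact monomial_sub_monomial_mem_span_Jset k e (Prod.ext_iff.1 hij).2 (Prod.ext_iff.1 hij).1
  · rw [Ideal.span_le]
    simp only [Set.iUnion_subset_iff]
    rintro s - _ ⟨α, β, rfl⟩
    exact Tab_mem_ker k e α β
end

section
/- Let α, β : Fin s → Fin n be two sequences of length s ≥ 2. If α(i₀) = β(j₀) for some indices i₀ and j₀, then T_{α,β} ∈ span(J_1 ∪ J_2 ∪ … ∪ J_{s-1}). -/
open MvPolynomial

variable (k : Type*) [Field k] {σ : Type*} {n : ℕ}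

/-- An entry common to `α` and `β` factors out of `T_{α,β}`. -/
theorem Tab_eq_X_mul_Tab_succAbove (e : Fin n → (σ →₀ ℕ)) {m : ℕ} (α β : Fin (m + 1) → Fin n)
    (i₀ j₀ : Fin (m + 1)) (h : α i₀ = β j₀) :
    Tab k e α β = X (α i₀) * Tab k e (α ∘ i₀.succAbove) (β ∘ j₀.succAbove) := by
  have exp_sub (c a b : σ →₀ ℕ) : (c + a) - expGcd (c + a) (c + b) = a - expGcd a b := by
    ext x
    simp only [expGcd, Finsupp.tsub_apply, Finsupp.add_apply, Finsupp.inf_apply]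
    omega
  have exp_sub' (c a b : σ →₀ ℕ) : (c + b) - expGcd (c + a) (c + b) = b - expGcd a b := by
    ext x
    simp only [expGcd, Finsupp.tsub_apply, Finsupp.add_apply, Finsupp.inf_apply]
    omega
  simp only [Tab, Function.comp_apply]
  rw [Fin.sum_univ_succAbove (fun i => e (α i)) i₀, Fin.sum_univ_succAbove (fun i => e (β i)) j₀,
    Fin.prod_univ_succAbove _ i₀, Fin.prod_univ_succAbove _ j₀, ← h, exp_sub, exp_sub']
  ring

/-- If `α(i₀) = β(j₀)` for some indices `i₀`, `j₀`, then
`T_{α,β} ∈ span(J_1 ∪ J_2 ∪ … ∪ J_{s-1})`. -/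
theorem Tab_mem_of_common_entry
    (e : Fin n → (σ →₀ ℕ)) (hsf : ∀ i, SqFreeExp (e i))
    (hmin : ∀ i j : Fin n, i ≠ j →
      ¬ ((monomial (e i) (1 : k) : MvPolynomial σ k) ∣ monomial (e j) (1 : k)))
    {s : ℕ} (hs : 2 ≤ s) (α β : Fin s → Fin n)
    (i₀ j₀ : Fin s) (h : α i₀ = β j₀) :
    Tab k e α β ∈ Ideal.span (⋃ i ∈ Set.Icc 1 (s - 1), Jset k e i) := by
  obtain ⟨m, rfl⟩ : ∃ m, s = m + 1 := ⟨s - 1, by omega⟩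
  rw [Tab_eq_X_mul_Tab_succAbove k e α β i₀ j₀ h]
  refine Ideal.mul_mem_left _ _ (Ideal.subset_span (Set.mem_biUnion (x := m) ?_ ⟨_, _, rfl⟩))
  exact ⟨by omega, by omega⟩
end

section
/- Let α, β : Fin s → Fin n be two sequences of length s ≥ 2. Suppose s = l·m for positive integers l and m with m ≤ s, and there are sequences α₁, β₁ : Fin m → Fin n such that α is the concatenation of l copies of α₁ and β is the concatenation of l copies of β₁. Then T_{α,β} ∈ span(J_1 ∪ J_2 ∪ … ∪ J_m). -/
open MvPolynomial

variable (k : Type*) [Field k] {σ : Type*} {n : ℕ}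

@[to_additive]
theorem Fin.prod_comp_mod {M : Type*} [CommMonoid M] {l m : ℕ} (hm : 0 < m) (f : Fin m → M) :
    ∏ i : Fin (l * m), f ⟨i.val % m, Nat.mod_lt _ hm⟩ = (∏ j, f j) ^ l := by
  rw [← finProdFinEquiv.prod_comp, Fintype.prod_prod_type]
  simp [finProdFinEquiv, Nat.mod_eq_of_lt]

theorem nsmul_expGcd {σ : Type*} (l : ℕ) (a b : σ →₀ ℕ) :
    expGcd (l • a) (l • b) = l • expGcd a b := by
  ext x
  simp [expGcd, Nat.mul_min_mul_left]

theorem nsmul_tsub_finsupp {σ : Type*} (l : ℕ) (a b : σ →₀ ℕ) :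
    l • a - l • b = l • (a - b) := by
  ext x
  simp [Nat.mul_sub]

/-- The Taylor binomial of a pair of sequences divides that of their `l`-fold repetitions. -/
theorem Tab_dvd_Tab_repeat (e : Fin n → (σ →₀ ℕ)) {l m : ℕ} (hm : 0 < m)
    (α β : Fin m → Fin n) :
    Tab k e α β ∣ Tab k e (fun i : Fin (l * m) => α ⟨i.val % m, Nat.mod_lt _ hm⟩)
      (fun i : Fin (l * m) => β ⟨i.val % m, Nat.mod_lt _ hm⟩) := by
  unfold Tab
  rw [Fin.sum_comp_mod hm (fun j => e (α j)), Fin.sum_comp_mod hm (fun j => e (β j)),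
    Fin.prod_comp_mod hm (fun j => (X (α j) : MvPolynomial (Fin n) (MvPolynomial σ k))),
    Fin.prod_comp_mod hm (fun j => (X (β j) : MvPolynomial (Fin n) (MvPolynomial σ k))),
    nsmul_expGcd, nsmul_tsub_finsupp, nsmul_tsub_finsupp]
  have hpow (a : σ →₀ ℕ) : (monomial (l • a) (1 : k)) = monomial a 1 ^ l := by
    rw [monomial_pow, one_pow]
  rw [hpow, hpow, C_pow, C_pow, ← mul_pow, ← mul_pow]
  exact sub_dvd_pow_sub_pow _ _ l

/-- If `s = l·m` and `α`, `β` are the concatenations of `l` copies of sequences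
`α₁`, `β₁` of length `m`, then `T_{α,β} ∈ span(J_1 ∪ … ∪ J_m)`. -/
theorem Tab_mem_of_repeated
    (e : Fin n → (σ →₀ ℕ)) (hsf : ∀ i, SqFreeExp (e i))
    (hmin : ∀ i j : Fin n, i ≠ j →
      ¬ ((monomial (e i) (1 : k) : MvPolynomial σ k) ∣ monomial (e j) (1 : k)))
    {s : ℕ} (hs : 2 ≤ s) (α β : Fin s → Fin n)
    (l m : ℕ) (hl : 0 < l) (hm : 0 < m) (hlm : s = l * m) (hms : m ≤ s)
    (α₁ β₁ : Fin m → Fin n)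
    (hα : ∀ i : Fin s, α i = α₁ ⟨i.val % m, Nat.mod_lt _ hm⟩)
    (hβ : ∀ i : Fin s, β i = β₁ ⟨i.val % m, Nat.mod_lt _ hm⟩) :
    Tab k e α β ∈ Ideal.span (⋃ i ∈ Set.Icc 1 m, Jset k e i) := by
  subst hlm
  obtain rfl := funext hα
  obtain rfl := funext hβ
  refine Ideal.mem_of_dvd _ (Tab_dvd_Tab_repeat k e hm α₁ β₁) (Ideal.subset_span ?_)
  exact Set.mem_biUnion (Set.mem_Icc.2 ⟨hm, le_rfl⟩) ⟨α₁, β₁, rfl⟩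
end

section
/- (Splitting lemma) Let α, β : Fin s → Fin n with s ≥ 2, and suppose α and β are concatenations α = (α_1,…,α_m) and β = (β_1,…,β_m) of sequences α_i, β_i of length s_i with s_1 + … + s_m = s. Suppose that for every 1 ≤ i ≤ m there exists C_i ∈ R such that gcd(f_α, f_β) · C_i = gcd(∏_{j=1}^{i-1} f_{α_j}, f_β) · gcd(∏_{k=i}^{m} f_{α_k}, ∏_{k=i+1}^{m} f_{β_k}) · gcd(f_{α_i}, f_{β_i}), where empty products are 1. Then there exist A_1, …, A_m ∈ R such that T_{α,β} = Σ_{i=1}^{m} A_i · (∏_{j=i+1}^{m} T_{α_j}) · (∏_{k=1}^{i-1} T_{β_k}) · T_{α_i,β_i}; in particular T_{α,β} ∈ span(J_1 ∪ … ∪ J_r) where r = max{s_1,…,s_m}. -/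
open MvPolynomial

variable (k : Type*) [Field k] {σ : Type*} {n : ℕ}

/-- The index in `Fin (∑ i, sl i)` of the `j`-th entry of the `i`-th block in the
concatenation of sequences of lengths `sl 1, …, sl m`. -/
def blockIdx {m : ℕ} (sl : Fin m → ℕ) (i : Fin m) (j : Fin (sl i)) : Fin (∑ i', sl i') :=
  ⟨(∑ i' ∈ Finset.univ.filter (fun i' => i' < i), sl i') + j.val, by
    have hj := j.isLt
    have h1 : (∑ i' ∈ Finset.univ.filter (fun i' => i' < i), sl i') + sl i
        = ∑ i' ∈ insert i (Finset.univ.filter (fun i' => i' < i)), sl i' := by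
      rw [Finset.sum_insert (by simp)]; ring
    have h2 : ∑ i' ∈ insert i (Finset.univ.filter (fun i' => i' < i)), sl i'
        ≤ ∑ i', sl i' := Finset.sum_le_sum_of_subset (Finset.subset_univ _)
    omega⟩

/-- A product over a concatenation of blocks is the product of the products over the blocks. -/
@[to_additive]
theorem prod_eq_prod_blocks {M γ : Type*} [CommMonoid M] {s m : ℕ} (sl : Fin m → ℕ)
    (hsum : ∑ i, sl i = s) (α : Fin s → γ) (αs : (i : Fin m) → Fin (sl i) → γ)
    (hα : ∀ (i : Fin m) (j : Fin (sl i)), α (Fin.cast hsum (blockIdx sl i j)) = αs i j)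
    (F : γ → M) : ∏ j, F (α j) = ∏ i, ∏ j, F (αs i j) := by
  subst hsum
  rw [← finSigmaFinEquiv.prod_comp, Fintype.prod_sigma]
  refine Finset.prod_congr rfl fun i _ => Finset.prod_congr rfl fun j _ => ?_
  rw [← hα i j]
  congr 2
  ext
  rw [finSigmaFinEquiv_apply]
  simp only [blockIdx, Fin.val_cast, Nat.add_right_cancel_iff]
  refine Finset.sum_bij (fun x _ => Fin.castLE i.isLt.le x) (fun x _ => ?_)
    (fun x _ y _ h => by simpa using h) (fun y hy => ?_) (fun x _ => rfl)
  · exact Finset.mem_filter.mpr ⟨Finset.mem_univ _, x.isLt⟩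
  · exact ⟨⟨y, (Finset.mem_filter.mp hy).2⟩, Finset.mem_univ _, rfl⟩

theorem filter_val_le_eq_insert {m : ℕ} (i : Fin m) :
    Finset.univ.filter (fun j : Fin m => i.val ≤ j.val) =
      insert i (Finset.univ.filter (fun j => i < j)) := by
  ext j
  simp only [Finset.mem_filter, Finset.mem_univ, true_and, Finset.mem_insert, Fin.lt_def,
    Fin.ext_iff]
  omega

theorem filter_val_lt_succ_eq_insert {m : ℕ} (i : Fin m) :
    Finset.univ.filter (fun j : Fin m => j.val < i.val + 1) =
      insert i (Finset.univ.filter (fun j => j < i)) := by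
  ext j
  simp only [Finset.mem_filter, Finset.mem_univ, true_and, Finset.mem_insert, Fin.lt_def,
    Fin.ext_iff]
  omega

/-- Replacing the factors `p i` by `q i` one at a time, while exchanging `b i` for `a i` in the
monomial coefficient. -/
theorem sum_exchange_blocks {S : Type*} [CommRing S] [Algebra (MvPolynomial σ k) S] {m : ℕ}
    (a b : Fin m → σ →₀ ℕ) (g : σ →₀ ℕ) (p q : Fin m → S)
    (hg : ∀ i, g ≤ ∑ j with j < i, a j + ∑ j with i < j, b j + expGcd (a i) (b i)) :
    algebraMap (MvPolynomial σ k) S (monomial (∑ i, b i - g) 1) * ∏ i, p i -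
        algebraMap (MvPolynomial σ k) S (monomial (∑ i, a i - g) 1) * ∏ i, q i =
      ∑ i, algebraMap (MvPolynomial σ k) S
          (monomial (∑ j with j < i, a j + ∑ j with i < j, b j + expGcd (a i) (b i) - g) 1) *
        ((∏ j with i < j, p j) * (∏ j with j < i, q j) *
          (algebraMap (MvPolynomial σ k) S (monomial (b i - expGcd (a i) (b i)) 1) * p i -
            algebraMap (MvPolynomial σ k) S (monomial (a i - expGcd (a i) (b i)) 1) * q i)) := by
  let D : ℕ → S := fun t =>
    algebraMap (MvPolynomial σ k) S
        (monomial (∑ j : Fin m with j.val < t, a j + ∑ j : Fin m with t ≤ j.val, b j - g) 1) *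
      ((∏ j : Fin m with t ≤ j.val, p j) * ∏ j : Fin m with j.val < t, q j)
  have h0 : D 0 = algebraMap (MvPolynomial σ k) S (monomial (∑ i, b i - g) 1) * ∏ i, p i := by
    simp [D]
  have hm : D m = algebraMap (MvPolynomial σ k) S (monomial (∑ i, a i - g) 1) * ∏ i, q i := by
    simp [D, Finset.filter_false_of_mem, Fin.is_lt]
  rw [← h0, ← hm, ← Finset.sum_range_sub' D m, ← Fin.sum_univ_eq_sum_range
    (fun t => D t - D (t + 1))]
  refine Finset.sum_congr rfl fun i _ => ?_
  have hb : ∑ j : Fin m with j.val < i.val, a j + ∑ j : Fin m with i.val ≤ j.val, b j - g =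
      (∑ j with j < i, a j + ∑ j with i < j, b j + expGcd (a i) (b i) - g) +
        (b i - expGcd (a i) (b i)) := by
    rw [filter_val_le_eq_insert, Finset.sum_insert (by simp)]
    simp only [← Fin.lt_def]
    ext x
    have := hg i x
    simp only [expGcd, Finsupp.add_apply, Finsupp.tsub_apply, Finsupp.inf_apply] at this ⊢
    omega
  have ha : ∑ j : Fin m with j.val < i.val + 1, a j +
        ∑ j : Fin m with i.val + 1 ≤ j.val, b j - g =
      (∑ j with j < i, a j + ∑ j with i < j, b j + expGcd (a i) (b i) - g) +
        (a i - expGcd (a i) (b i)) := by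
    rw [filter_val_lt_succ_eq_insert, Finset.sum_insert (by simp)]
    simp only [Nat.succ_le_iff, ← Fin.lt_def]
    ext x
    have := hg i x
    simp only [expGcd, Finsupp.add_apply, Finsupp.tsub_apply, Finsupp.inf_apply] at this ⊢
    omega
  have hmul (u v : σ →₀ ℕ) : (monomial (u + v) 1 : MvPolynomial σ k) =
      monomial u 1 * monomial v 1 := by simp [monomial_mul]
  simp only [D]
  rw [hb, ha, filter_val_lt_succ_eq_insert, filter_val_le_eq_insert,
    Finset.prod_insert (by simp), Finset.prod_insert (by simp), hmul, hmul, map_mul, map_mul]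
  simp only [Nat.succ_le_iff, ← Fin.lt_def]
  ring

theorem Tab_eq_zero_of_length_eq_zero (e : Fin n → (σ →₀ ℕ)) {s : ℕ} (hs : s = 0)
    (α β : Fin s → Fin n) : Tab k e α β = 0 := by
  subst hs
  simp [Tab]

/-- **(Splitting lemma)** If `α`, `β` are concatenations of blocks `αs i`, `βs i` of lengths
`sl i` with `∑ sl i = s`, and for every `i` there is `Cᵢ ∈ R` with
`gcd(f_α, f_β) ⬝ Cᵢ = gcd(∏_{j<i} f_{α_j}, f_β) ⬝ gcd(∏_{j≥i} f_{α_j}, ∏_{j>i} f_{β_j}) ⬝ gcd(f_{α_i}, f_{β_i})`,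
then there are `A_1, …, A_m ∈ R` with
`T_{α,β} = ∑ i, A_i ⬝ (∏_{j>i} T_{α_j}) ⬝ (∏_{j<i} T_{β_j}) ⬝ T_{α_i,β_i}`; in particular
`T_{α,β} ∈ span(J_1 ∪ … ∪ J_r)` where `r = max {sl 1, …, sl m}`. -/
theorem Tab_splitting
    (e : Fin n → (σ →₀ ℕ)) (hsf : ∀ i, SqFreeExp (e i))
    (hmin : ∀ i j : Fin n, i ≠ j →
      ¬ ((monomial (e i) (1 : k) : MvPolynomial σ k) ∣ monomial (e j) (1 : k)))
    {s : ℕ} (hs : 2 ≤ s) (α β : Fin s → Fin n)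
    (m : ℕ) (sl : Fin m → ℕ) (hsum : ∑ i, sl i = s)
    (αs βs : (i : Fin m) → Fin (sl i) → Fin n)
    (hα : ∀ (i : Fin m) (j : Fin (sl i)), α (Fin.cast hsum (blockIdx sl i j)) = αs i j)
    (hβ : ∀ (i : Fin m) (j : Fin (sl i)), β (Fin.cast hsum (blockIdx sl i j)) = βs i j)
    (hC : ∀ i : Fin m, ∃ Ci : MvPolynomial σ k,
      monomial (expGcd (∑ j, e (α j)) (∑ j, e (β j))) (1 : k) * Ci =
        monomial (expGcd (∑ i' ∈ Finset.univ.filter (fun i' => i' < i), ∑ j, e (αs i' j))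
            (∑ j, e (β j))) (1 : k) *
          monomial (expGcd (∑ i' ∈ Finset.univ.filter (fun i' => i ≤ i'), ∑ j, e (αs i' j))
            (∑ i' ∈ Finset.univ.filter (fun i' => i < i'), ∑ j, e (βs i' j))) (1 : k) *
          monomial (expGcd (∑ j, e (αs i j)) (∑ j, e (βs i j))) (1 : k)) :
    (∃ A : Fin m → MvPolynomial σ k,
      Tab k e α β = ∑ i : Fin m, C (A i) *
        ((∏ i' ∈ Finset.univ.filter (fun i' => i < i'), ∏ j, X (αs i' j)) *
          (∏ i' ∈ Finset.univ.filter (fun i' => i' < i), ∏ j, X (βs i' j)) *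
          Tab k e (αs i) (βs i))) ∧
    Tab k e α β ∈ Ideal.span (⋃ r ∈ Set.Icc 1 (Finset.univ.sup sl), Jset k e r) := by
  have hg (i : Fin m) : expGcd (∑ j, e (α j)) (∑ j, e (β j)) ≤
      ∑ i' with i' < i, ∑ j, e (αs i' j) + ∑ i' with i < i', ∑ j, e (βs i' j) +
        expGcd (∑ j, e (αs i j)) (∑ j, e (βs i j)) := by
    obtain ⟨c, hc⟩ := hC i
    simp only [monomial_mul, mul_one] at hc
    have hle := (monomial_dvd_monomial.mp (Dvd.intro c hc)).1.resolve_left one_ne_zero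
    refine hle.trans ?_
    gcongr
    · exact inf_le_left
    · exact inf_le_right
  have key : Tab k e α β = ∑ i : Fin m,
      C (monomial (∑ i' with i' < i, ∑ j, e (αs i' j) + ∑ i' with i < i', ∑ j, e (βs i' j) +
        expGcd (∑ j, e (αs i j)) (∑ j, e (βs i j)) -
          expGcd (∑ j, e (α j)) (∑ j, e (β j))) (1 : k)) *
        ((∏ i' ∈ Finset.univ.filter (fun i' => i < i'), ∏ j, X (αs i' j)) *
          (∏ i' ∈ Finset.univ.filter (fun i' => i' < i), ∏ j, X (βs i' j)) *
          Tab k e (αs i) (βs i)) := by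
    have h := sum_exchange_blocks k (S := MvPolynomial (Fin n) (MvPolynomial σ k))
      (fun i => ∑ j, e (αs i j)) (fun i => ∑ j, e (βs i j)) _
      (fun i => ∏ j, X (αs i j)) (fun i => ∏ j, X (βs i j)) hg
    rw [← sum_eq_sum_blocks sl hsum α αs hα e, ← sum_eq_sum_blocks sl hsum β βs hβ e,
      ← prod_eq_prod_blocks sl hsum α αs hα, ← prod_eq_prod_blocks sl hsum β βs hβ] at h
    exact h
  refine ⟨⟨_, key⟩, ?_⟩
  rw [key]
  refine Ideal.sum_mem _ fun i _ => Ideal.mul_mem_left _ _ (Ideal.mul_mem_left _ _ ?_)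
  rcases Nat.eq_zero_or_pos (sl i) with hi | hi
  · rw [Tab_eq_zero_of_length_eq_zero k e hi]
    exact Ideal.zero_mem _
  · exact Ideal.subset_span (Set.mem_biUnion
      ⟨hi, Finset.le_sup (Finset.mem_univ i)⟩ ⟨αs i, βs i, rfl⟩)
end

section
/- Let α, β : Fin s → Fin n be two sequences of length s ≥ 2 (with entries written α = (a_1,…,a_s), β = (b_1,…,b_s)). Suppose there exist integers k, l with 1 ≤ k, l ≤ s−1 such that gcd(f_{a_i}, f_{b_j}) = 1 for every 1 ≤ i ≤ l and every k+1 ≤ j ≤ s, and gcd(f_{a_u}, f_{b_v}) = 1 for every l+1 ≤ u ≤ s and every 1 ≤ v ≤ k. Then T_{α,β} ∈ span(J_1 ∪ J_2 ∪ … ∪ J_r), where r = max{k, |k−l|, s−k, s−l}. -/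
open MvPolynomial

variable (k : Type*) [Field k] {σ : Type*} {n : ℕ}

/-- If the exponents of the gcd of `X ^ (p + q)` and `X ^ (b + c)` are small enough, the binomial
relation between `P * Q` and `B * D` follows from the one between `P` and `B` and the one between
`Q` and `D`, rewriting `P` to `B` first. -/
theorem binomial_mul_mem_of_expGcd_le
    (I : Ideal (MvPolynomial (Fin n) (MvPolynomial σ k)))
    {P Q B D : MvPolynomial (Fin n) (MvPolynomial σ k)} {p q b c : σ →₀ ℕ}
    (hPB : C (monomial (b - expGcd p b) (1 : k)) * P
      - C (monomial (p - expGcd p b) (1 : k)) * B ∈ I)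
    (hQD : C (monomial (c - expGcd q c) (1 : k)) * Q
      - C (monomial (q - expGcd q c) (1 : k)) * D ∈ I)
    (hc : expGcd (p + q) (b + c) ≤ c + expGcd p b)
    (hp : expGcd (p + q) (b + c) ≤ p + expGcd q c) :
    C (monomial ((b + c) - expGcd (p + q) (b + c)) (1 : k)) * (P * Q)
      - C (monomial ((p + q) - expGcd (p + q) (b + c)) (1 : k)) * (B * D) ∈ I := by
  obtain ⟨u, hu⟩ := exists_add_of_le hc
  obtain ⟨v, hv⟩ := exists_add_of_le hp
  have hbc : (b + c) - expGcd (p + q) (b + c) = u + (b - expGcd p b) := by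
    ext x
    have := DFunLike.congr_fun hu x
    simp only [expGcd, Finsupp.coe_add, Finsupp.coe_tsub, Pi.add_apply, Pi.sub_apply,
      Finsupp.inf_apply] at this ⊢
    omega
  have hmid : u + (p - expGcd p b) = v + (c - expGcd q c) := by
    ext x
    have h₁ := DFunLike.congr_fun hu x
    have h₂ := DFunLike.congr_fun hv x
    simp only [expGcd, Finsupp.coe_add, Finsupp.coe_tsub, Pi.add_apply, Pi.sub_apply,
      Finsupp.inf_apply] at h₁ h₂ ⊢
    omega
  have hpq : (p + q) - expGcd (p + q) (b + c) = v + (q - expGcd q c) := by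
    ext x
    have := DFunLike.congr_fun hv x
    simp only [expGcd, Finsupp.coe_add, Finsupp.coe_tsub, Pi.add_apply, Pi.sub_apply,
      Finsupp.inf_apply] at this ⊢
    omega
  have C_monomial_add (d d' : σ →₀ ℕ) :
      (C (monomial (d + d') (1 : k)) : MvPolynomial (Fin n) (MvPolynomial σ k)) =
        C (monomial d 1) * C (monomial d' 1) := by
    rw [← C_mul, monomial_mul, one_mul]
  have key := congrArg
    (fun d => (C (monomial d (1 : k)) : MvPolynomial (Fin n) (MvPolynomial σ k))) hmid
  simp only [C_monomial_add] at key
  rw [hbc, hpq, C_monomial_add, C_monomial_add]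
  convert I.add_mem (I.mul_mem_left (C (monomial u (1 : k)) * Q) hPB)
    (I.mul_mem_left (C (monomial v (1 : k)) * B) hQD) using 1
  linear_combination (B * Q) * key

/-- `Tab` of two concatenated sequences lies in every ideal containing `Tab` of the two pieces,
provided that the supports of the monomials involved are suitably disjoint. -/
theorem Tab_mem_of_Tab_split_mem (e : Fin n → (σ →₀ ℕ)) {s t : ℕ} (α β : Fin (s + t) → Fin n)
    (I : Ideal (MvPolynomial (Fin n) (MvPolynomial σ k)))
    (hfst : Tab k e (fun i => α (Fin.castAdd t i)) (fun i => β (Fin.castAdd t i)) ∈ I)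
    (hsnd : Tab k e (fun i => α (Fin.natAdd s i)) (fun i => β (Fin.natAdd s i)) ∈ I)
    (hdisj : ∀ (x : σ) (i : Fin s) (j : Fin t), e (β (Fin.castAdd t i)) x = 0 ∨
      e (β (Fin.natAdd s j)) x = 0 ∨ ∀ u, e (α u) x = 0)
    (hcross : (∀ (x : σ) (i : Fin s) (j : Fin t), e (β (Fin.castAdd t i)) x = 0 ∨
        e (α (Fin.natAdd s j)) x = 0) ∨
      ∀ (x : σ) (i : Fin s) (j : Fin t), e (α (Fin.castAdd t i)) x = 0 ∨
        e (β (Fin.natAdd s j)) x = 0) :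
    Tab k e α β ∈ I := by
  unfold Tab at hfst hsnd ⊢
  simp only [Fin.sum_univ_add, Fin.prod_univ_add]
  set p := ∑ i : Fin s, e (α (Fin.castAdd t i)) with hp
  set q := ∑ i : Fin t, e (α (Fin.natAdd s i)) with hq
  set b := ∑ i : Fin s, e (β (Fin.castAdd t i))
  set c := ∑ i : Fin t, e (β (Fin.natAdd s i))
  have sum_disj {m m' : ℕ} (f : Fin m → σ →₀ ℕ) (g : Fin m' → σ →₀ ℕ) (x : σ)
      (h : ∀ i j, f i x = 0 ∨ g j x = 0) : (∑ i, f i) x = 0 ∨ (∑ j, g j) x = 0 := by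
    simp only [Finsupp.finsetSum_apply, Finset.sum_eq_zero_iff, Finset.mem_univ, true_imp_iff]
    by_contra! hne
    obtain ⟨⟨i, hi⟩, j, hj⟩ := hne
    exact (h i j).elim hi hj
  have hbc (x : σ) : b x = 0 ∨ c x = 0 ∨ (p x = 0 ∧ q x = 0) := by
    by_cases h : ∀ u, e (α u) x = 0
    · exact .inr (.inr (by simp [hp, hq, Finsupp.finsetSum_apply, h]))
    · rcases sum_disj _ _ x fun i j => (hdisj x i j).imp_right fun h' => h'.resolve_right h
        with h' | h'
      · exact .inl h'
      · exact .inr (.inl h')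
  rcases hcross with hcross | hcross
  · have hbq (x : σ) : b x = 0 ∨ q x = 0 := sum_disj _ _ x (hcross x)
    refine binomial_mul_mem_of_expGcd_le k I hfst hsnd ?_ ?_ <;> intro x <;>
      have h₁ := hbc x <;> have h₂ := hbq x <;>
      simp only [expGcd, Finsupp.coe_add, Pi.add_apply, Finsupp.inf_apply] <;> omega
  · have hpc (x : σ) : p x = 0 ∨ c x = 0 := sum_disj _ _ x (hcross x)
    rw [add_comm p q, add_comm b c, mul_comm (∏ i : Fin s, X (α (Fin.castAdd t i))),
      mul_comm (∏ i : Fin s, X (β (Fin.castAdd t i)))]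
    refine binomial_mul_mem_of_expGcd_le k I hsnd hfst ?_ ?_ <;> intro x <;>
      have h₁ := hbc x <;> have h₂ := hpc x <;>
      simp only [expGcd, Finsupp.coe_add, Pi.add_apply, Finsupp.inf_apply] <;> omega

/-- Monomials with trivial gcd have no variable in common. -/
theorem apply_eq_zero_or_of_monomial_expGcd_eq_one {a b : σ →₀ ℕ}
    (h : (monomial (expGcd a b) (1 : k) : MvPolynomial σ k) = 1) (x : σ) :
    a x = 0 ∨ b x = 0 := by
  have hab := DFunLike.congr_fun (monomial_left_injective (one_ne_zero (α := k)) h) x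
  simp only [expGcd, Finsupp.inf_apply, Finsupp.coe_zero, Pi.zero_apply] at hab
  omega

/-- If, after reordering, there are `1 ≤ kk, ll ≤ s-1` such that the first `ll` entries of
`α` are coprime to the last `s - kk` entries of `β`, and the last `s - ll` entries of `α`
are coprime to the first `kk` entries of `β`, then
`T_{α,β} ∈ span(J_1 ∪ … ∪ J_r)` with `r = max {kk, |kk - ll|, s - kk, s - ll}`. -/
theorem Tab_mem_of_coprime_split
    (e : Fin n → (σ →₀ ℕ)) (hsf : ∀ i, SqFreeExp (e i))
    (hmin : ∀ i j : Fin n, i ≠ j →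
      ¬ ((monomial (e i) (1 : k) : MvPolynomial σ k) ∣ monomial (e j) (1 : k)))
    {s : ℕ} (hs : 2 ≤ s) (α β : Fin s → Fin n)
    (kk ll : ℕ) (hk1 : 1 ≤ kk) (hk2 : kk ≤ s - 1) (hl1 : 1 ≤ ll) (hl2 : ll ≤ s - 1)
    (h1 : ∀ i j : Fin s, i.val < ll → kk ≤ j.val →
      (monomial (expGcd (e (α i)) (e (β j))) (1 : k) : MvPolynomial σ k) = 1)
    (h2 : ∀ u v : Fin s, ll ≤ u.val → v.val < kk →
      (monomial (expGcd (e (α u)) (e (β v))) (1 : k) : MvPolynomial σ k) = 1) :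
    Tab k e α β ∈ Ideal.span (⋃ i ∈ Set.Icc 1
      (max (max kk (max (kk - ll) (ll - kk))) (max (s - kk) (s - ll))), Jset k e i) := by
  obtain ⟨t, rfl⟩ := Nat.exists_eq_add_of_le (show kk ≤ s by omega)
  have Tab_mem {m : ℕ} (hm : m = kk ∨ m = t) (γ δ : Fin m → Fin n) :
      Tab k e γ δ ∈ Ideal.span (⋃ i ∈ Set.Icc 1
        (max (max kk (max (kk - ll) (ll - kk))) (max (kk + t - kk) (kk + t - ll))),
        Jset k e i) := by
    refine Ideal.subset_span (Set.mem_biUnion (x := m) ?_ ⟨γ, δ, rfl⟩)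
    rw [Set.mem_Icc]
    omega
  have hlow (i j : Fin (kk + t)) (hi : i.val < ll) (hj : kk ≤ j.val) (x : σ) :
      e (α i) x = 0 ∨ e (β j) x = 0 :=
    apply_eq_zero_or_of_monomial_expGcd_eq_one k (h1 i j hi hj) x
  have hhigh (u v : Fin (kk + t)) (hu : ll ≤ u.val) (hv : v.val < kk) (x : σ) :
      e (α u) x = 0 ∨ e (β v) x = 0 :=
    apply_eq_zero_or_of_monomial_expGcd_eq_one k (h2 u v hu hv) x
  refine Tab_mem_of_Tab_split_mem k e α β _ (Tab_mem (.inl rfl) _ _) (Tab_mem (.inr rfl) _ _)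
    (fun x i j => ?_) ?_
  · by_cases hi : e (β (Fin.castAdd t i)) x = 0
    · exact .inl hi
    by_cases hj : e (β (Fin.natAdd kk j)) x = 0
    · exact .inr (.inl hj)
    refine .inr (.inr fun u => ?_)
    rcases lt_or_ge u.val ll with hu | hu
    · exact (hlow u (Fin.natAdd kk j) hu (by simp) x).resolve_right hj
    · exact (hhigh u (Fin.castAdd t i) hu (by simp) x).resolve_right hi
  · rcases le_total ll kk with hlk | hkl
    · refine .inl fun x i j => (hhigh (Fin.natAdd kk j) (Fin.castAdd t i) ?_ (by simp) x).symm
      rw [Fin.val_natAdd]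
      omega
    · refine .inr fun x i j => hlow (Fin.castAdd t i) (Fin.natAdd kk j) ?_ (by simp) x
      rw [Fin.val_castAdd]
      omega
end

section
/- Let α, β : Fin s → Fin n be two sequences of length s ≥ 2, and suppose α is constant (α(i) = a for all i). Then T_{α,β} ∈ span(J_1 ∪ J_2 ∪ … ∪ J_{s-1}). -/
open MvPolynomial

variable (k : Type*) [Field k] {σ : Type*} {n : ℕ}

theorem expGcd_le_left (u v : σ →₀ ℕ) : expGcd u v ≤ u := inf_le_left

theorem expGcd_le_right (u v : σ →₀ ℕ) : expGcd u v ≤ v := inf_le_right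

/-- The gcd of a power of a square-free monomial with a product of square-free monomials
is the product of the gcds with the factors. -/
theorem expGcd_sum_const {ι : Type*} (t : Finset ι) {u : σ →₀ ℕ} (hu : SqFreeExp u)
    {v : ι → σ →₀ ℕ} (hv : ∀ i, SqFreeExp (v i)) :
    expGcd (∑ _i ∈ t, u) (∑ i ∈ t, v i) = ∑ i ∈ t, expGcd u (v i) := by
  ext x
  simp only [expGcd, Finsupp.inf_apply, Finsupp.finsetSum_apply]
  rcases Nat.le_one_iff_eq_zero_or_eq_one.mp (hu x) with h | h
  · simp [h]
  · rw [inf_eq_right.mpr (Finset.sum_le_sum fun i _ => (hv i x).trans h.ge)]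
    exact Finset.sum_congr rfl fun i _ => (inf_eq_right.mpr ((hv i x).trans h.ge)).symm

theorem sum_tsub_sum_of_le {ι : Type*} (t : Finset ι) {u v : ι → σ →₀ ℕ}
    (h : ∀ i, v i ≤ u i) :
    ∑ i ∈ t, u i - ∑ i ∈ t, v i = ∑ i ∈ t, (u i - v i) := by
  ext x
  simp only [Finsupp.tsub_apply, Finsupp.finsetSum_apply]
  exact (Finset.sum_tsub_distrib t fun i _ => h i x).symm

theorem prod_sub_prod_mem {ι A : Type*} [CommRing A] (I : Ideal A) (t : Finset ι)
    {u v : ι → A} (h : ∀ i ∈ t, u i - v i ∈ I) :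
    ∏ i ∈ t, u i - ∏ i ∈ t, v i ∈ I := by
  rw [← Ideal.Quotient.eq, map_prod, map_prod]
  exact Finset.prod_congr rfl fun i hi => Ideal.Quotient.eq.mpr (h i hi)

/-- Over a constant sequence, a Taylor binomial of square-free monomials lies in the ideal
generated by the linear ones. -/
theorem Tab_const_mem_span_Jset_one (e : Fin n → (σ →₀ ℕ)) (hsf : ∀ i, SqFreeExp (e i))
    {s : ℕ} (a : Fin n) (β : Fin s → Fin n) :
    Tab k e (fun _ => a) β ∈ Ideal.span (Jset k e 1) := by
  have hgcd : expGcd (∑ _i : Fin s, e a) (∑ i, e (β i)) = ∑ i, expGcd (e a) (e (β i)) :=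
    expGcd_sum_const _ (hsf a) fun i => hsf (β i)
  rw [Tab, hgcd, sum_tsub_sum_of_le _ fun i => expGcd_le_right (e a) (e (β i)),
    sum_tsub_sum_of_le _ fun i => expGcd_le_left (e a) (e (β i)),
    monomial_sum_one, monomial_sum_one, map_prod, map_prod, ← Finset.prod_mul_distrib,
    ← Finset.prod_mul_distrib]
  refine prod_sub_prod_mem _ _ fun i _ => Ideal.subset_span ⟨fun _ => a, fun _ => β i, ?_⟩
  simp [Tab]

/-- If `α` is a constant sequence, then `T_{α,β} ∈ span(J_1 ∪ … ∪ J_{s-1})`. -/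
theorem Tab_mem_of_constant
    (e : Fin n → (σ →₀ ℕ)) (hsf : ∀ i, SqFreeExp (e i))
    (hmin : ∀ i j : Fin n, i ≠ j →
      ¬ ((monomial (e i) (1 : k) : MvPolynomial σ k) ∣ monomial (e j) (1 : k)))
    {s : ℕ} (hs : 2 ≤ s) (α β : Fin s → Fin n)
    (a : Fin n) (hα : ∀ i, α i = a) :
    Tab k e α β ∈ Ideal.span (⋃ i ∈ Set.Icc 1 (s - 1), Jset k e i) := by
  obtain rfl : α = fun _ => a := funext hα
  have hone : 1 ∈ Set.Icc 1 (s - 1) := ⟨le_rfl, by omega⟩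
  exact Ideal.span_mono (Set.subset_biUnion_of_mem (u := Jset k e) hone)
    (Tab_const_mem_span_Jset_one k e hsf a β)
end

section
/- Let α, β : Fin s → Fin n be two sequences of length s ≥ 2. Suppose the image of α has at most 2 distinct elements and the image of β has at most 2 distinct elements (i.e. α = (a_1,…,a_1,a_2,…,a_2) and β = (b_1,…,b_1,b_2,…,b_2)). Then T_{α,β} ∈ span(J_1 ∪ J_2). -/
open MvPolynomial

variable (k : Type*) [Field k] {σ : Type*} {n : ℕ}

/-- The exponent vector of the monomial `∏ f_i`, the product running over a multiset of indices. -/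
noncomputable def multisetExp (e : Fin n → (σ →₀ ℕ)) (A : Multiset (Fin n)) : σ →₀ ℕ :=
  (A.map e).sum

/-- The term of the variables indexed by `A` whose image under the Rees map has
coefficient exponent `L`, provided `multisetExp e A ≤ L`. -/
noncomputable def fiberTerm (e : Fin n → (σ →₀ ℕ)) (L : σ →₀ ℕ) (A : Multiset (Fin n)) :
    MvPolynomial (Fin n) (MvPolynomial σ k) :=
  C (monomial (L - multisetExp e A) (1 : k)) * (A.map X).prod

lemma multisetExp_add (e : Fin n → (σ →₀ ℕ)) (A B : Multiset (Fin n)) :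
    multisetExp e (A + B) = multisetExp e A + multisetExp e B := by
  simp [multisetExp]

lemma multisetExp_map_univ (e : Fin n → (σ →₀ ℕ)) {s : ℕ} (α : Fin s → Fin n) :
    multisetExp e (Finset.univ.val.map α) = ∑ i, e (α i) := by
  simp only [multisetExp, Multiset.map_map, Function.comp_def]
  rfl

lemma fiberTerm_add_right (e : Fin n → (σ →₀ ℕ)) (L : σ →₀ ℕ) (A B : Multiset (Fin n)) :
    fiberTerm k e L (A + B) = fiberTerm k e (L - multisetExp e B) A * (B.map X).prod := by
  simp only [fiberTerm, multisetExp_add, Multiset.map_add, Multiset.prod_add]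
  rw [add_comm (multisetExp e A), ← tsub_tsub, mul_assoc]

lemma fiberTerm_sub_fiberTerm_eq_mul_Tab (e : Fin n → (σ →₀ ℕ)) {s : ℕ} (α β : Fin s → Fin n)
    {L : σ →₀ ℕ} (hα : ∑ i, e (α i) ≤ L) (hβ : ∑ i, e (β i) ≤ L) :
    fiberTerm k e L (Finset.univ.val.map α) - fiberTerm k e L (Finset.univ.val.map β) =
      C (monomial (L - (∑ i, e (α i)) ⊔ ∑ i, e (β i)) (1 : k)) * Tab k e α β := by
  have prod_eq (γ : Fin s → Fin n) :
      ((Finset.univ.val.map γ).map (X : Fin n → MvPolynomial (Fin n) (MvPolynomial σ k))).prod =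
        ∏ i, X (γ i) := by
    simp only [Multiset.map_map, Function.comp_def]
    rfl
  have h₁ : L - ∑ i, e (α i) = (L - (∑ i, e (α i)) ⊔ ∑ i, e (β i)) +
      ((∑ i, e (β i)) - expGcd (∑ i, e (α i)) (∑ i, e (β i))) := by
    ext x
    have := hα x
    have := hβ x
    simp only [expGcd, Finsupp.tsub_apply, Finsupp.add_apply, Finsupp.sup_apply,
      Finsupp.inf_apply]
    omega
  have h₂ : L - ∑ i, e (β i) = (L - (∑ i, e (α i)) ⊔ ∑ i, e (β i)) +
      ((∑ i, e (α i)) - expGcd (∑ i, e (α i)) (∑ i, e (β i))) := by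
    ext x
    have := hα x
    have := hβ x
    simp only [expGcd, Finsupp.tsub_apply, Finsupp.add_apply, Finsupp.sup_apply,
      Finsupp.inf_apply]
    omega
  have monomial_add (a b : σ →₀ ℕ) :
      monomial (a + b) (1 : k) = monomial a 1 * monomial b 1 := by
    simp [monomial_mul]
  simp only [fiberTerm, multisetExp_map_univ, prod_eq, Tab]
  rw [h₁, h₂, monomial_add, monomial_add, C_mul, C_mul]
  ring

lemma exists_map_univ_eq {s : ℕ} {A : Multiset (Fin n)} (hA : A.card = s) :
    ∃ α : Fin s → Fin n, Finset.univ.val.map α = A := by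
  subst hA
  induction A using Quotient.inductionOn with
  | _ l =>
    refine ⟨l.get, ?_⟩
    change Multiset.map l.get (Finset.univ : Finset (Fin l.length)).val = l
    rw [Fin.univ_val_map, List.ofFn_get]

lemma exists_eq_replicate_add_replicate {ι : Type*} {A : Multiset ι} {a b : ι}
    (hA : ∀ x ∈ A, x = a ∨ x = b) :
    ∃ p q, A = Multiset.replicate p a + Multiset.replicate q b := by
  classical
  refine ⟨_, _, (Multiset.filter_add_not (· = a) A).symm.trans (congrArg₂ _
    (Multiset.eq_replicate_card.2 fun x hx => (Multiset.mem_filter.1 hx).2)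
    (Multiset.eq_replicate_card.2 fun x hx => ?_))⟩
  obtain ⟨hx, hxa⟩ := Multiset.mem_filter.1 hx
  exact (hA x hx).resolve_left hxa

lemma fiberTerm_sub_mem_of_card_le_two (e : Fin n → (σ →₀ ℕ)) {P Q : Multiset (Fin n)}
    (hP : P.card = 1 ∨ P.card = 2) (hQ : Q.card = P.card) {L : σ →₀ ℕ}
    (hPL : multisetExp e P ≤ L) (hQL : multisetExp e Q ≤ L) :
    fiberTerm k e L P - fiberTerm k e L Q ∈ Ideal.span (Jset k e 1 ∪ Jset k e 2) := by
  obtain ⟨s, hs⟩ : ∃ s, P.card = s := ⟨_, rfl⟩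
  obtain ⟨α, rfl⟩ := exists_map_univ_eq hs
  obtain ⟨β, rfl⟩ := exists_map_univ_eq (hQ.trans hs)
  rw [multisetExp_map_univ] at hPL hQL
  rw [fiberTerm_sub_fiberTerm_eq_mul_Tab k e α β hPL hQL]
  refine Ideal.mul_mem_left _ _ (Ideal.subset_span ?_)
  rw [hs] at hP
  rcases hP with rfl | rfl
  · exact Or.inl ⟨α, β, rfl⟩
  · exact Or.inr ⟨α, β, rfl⟩

/-- Exchanging a sub-multiset `P` of size at most two for `Q` reduces membership to the
complements of `P` and `Q`. -/
lemma fiberTerm_sub_mem_of_exchange (e : Fin n → (σ →₀ ℕ)) {P Q A B : Multiset (Fin n)}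
    (hP : P.card = 1 ∨ P.card = 2) (hQ : Q.card = P.card) {L : σ →₀ ℕ}
    (hPA : multisetExp e (P + A) ≤ L) (hQA : multisetExp e (Q + A) ≤ L)
    (hQB : multisetExp e (Q + B) ≤ L)
    (ih : ∀ M : σ →₀ ℕ, multisetExp e A ≤ M → multisetExp e B ≤ M →
      fiberTerm k e M A - fiberTerm k e M B ∈ Ideal.span (Jset k e 1 ∪ Jset k e 2)) :
    fiberTerm k e L (P + A) - fiberTerm k e L (Q + B) ∈
      Ideal.span (Jset k e 1 ∪ Jset k e 2) := by
  rw [multisetExp_add] at hPA hQA hQB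
  rw [← sub_add_sub_cancel _ (fiberTerm k e L (Q + A))]
  refine add_mem ?_ ?_
  · rw [fiberTerm_add_right, fiberTerm_add_right, ← sub_mul]
    exact Ideal.mul_mem_right _ _ (fiberTerm_sub_mem_of_card_le_two k e hP hQ
      (le_tsub_of_add_le_right hPA) (le_tsub_of_add_le_right hQA))
  · rw [add_comm Q A, add_comm Q B, fiberTerm_add_right, fiberTerm_add_right, ← sub_mul]
    exact Ideal.mul_mem_right _ _
      (ih _ (le_tsub_of_add_le_left hQA) (le_tsub_of_add_le_left hQB))

open Multiset in
lemma fiberTerm_replicate_sub_mem (e : Fin n → (σ →₀ ℕ)) (hsf : ∀ i, SqFreeExp (e i))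
    (s : ℕ) : ∀ (a₁ a₂ b₁ b₂ : Fin n) (p q u v : ℕ), p + q = s → u + v = s → ∀ L : σ →₀ ℕ,
      multisetExp e (replicate p a₁ + replicate q a₂) ≤ L →
      multisetExp e (replicate u b₁ + replicate v b₂) ≤ L →
      fiberTerm k e L (replicate p a₁ + replicate q a₂) -
        fiberTerm k e L (replicate u b₁ + replicate v b₂) ∈
          Ideal.span (Jset k e 1 ∪ Jset k e 2) := by
  have exp_singleton (a : Fin n) : multisetExp e {a} = e a := by simp [multisetExp]
  have exp_replicate (m : ℕ) (a : Fin n) : multisetExp e (replicate m a) = m • e a := by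
    simp [multisetExp]
  induction s using Nat.strong_induction_on with
  | _ s ih =>
  -- the exchange of `a₂` for `b₁`, possible when `a₁` occurs less often than `b₁`
  have exchange (a₁ a₂ b₁ b₂ : Fin n) (p q u v : ℕ) (hpq : p + q = s) (huv : u + v = s)
      (hlt : p < u) (L : σ →₀ ℕ)
      (hA : multisetExp e (replicate p a₁ + replicate q a₂) ≤ L)
      (hB : multisetExp e (replicate u b₁ + replicate v b₂) ≤ L) :
      fiberTerm k e L (replicate p a₁ + replicate q a₂) -
        fiberTerm k e L (replicate u b₁ + replicate v b₂) ∈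
          Ideal.span (Jset k e 1 ∪ Jset k e 2) := by
    obtain ⟨q, rfl⟩ : ∃ q', q = q' + 1 := ⟨q - 1, by omega⟩
    obtain ⟨u, rfl⟩ : ∃ u', u = u' + 1 := ⟨u - 1, by omega⟩
    have eqA : replicate p a₁ + replicate (q + 1) a₂ =
        {a₂} + (replicate p a₁ + replicate q a₂) := by
      rw [replicate_succ, ← singleton_add]; abel
    have eqB : replicate (u + 1) b₁ + replicate v b₂ =
        {b₁} + (replicate u b₁ + replicate v b₂) := by
      rw [replicate_succ, ← singleton_add]; abel
    rw [eqA] at hA ⊢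
    rw [eqB] at hB ⊢
    refine fiberTerm_sub_mem_of_exchange k e (by simp) (by simp) hA ?_ hB
      (ih (p + q) (by omega) a₁ a₂ b₁ b₂ p q u v rfl (by omega))
    intro x
    have h₁ := hA x
    have h₂ := hB x
    have s₁ := hsf a₁ x
    have s₂ := hsf a₂ x
    have s₃ := hsf b₁ x
    simp only [multisetExp_add, exp_singleton, exp_replicate, Finsupp.add_apply,
      Finsupp.smul_apply, smul_eq_mul] at h₁ h₂ ⊢
    generalize v * e b₂ x = z at *
    interval_cases e a₁ x <;> interval_cases e a₂ x <;> interval_cases e b₁ x <;> omega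
  intro a₁ a₂ b₁ b₂ p q u v hpq huv L hA hB
  rcases lt_trichotomy p u with h | rfl | h
  · exact exchange a₁ a₂ b₁ b₂ p q u v hpq huv h L hA hB
  · obtain rfl : q = v := by omega
    rcases Nat.eq_zero_or_pos p with rfl | hp
    · rcases Nat.eq_zero_or_pos q with rfl | hq
      · simp
      · simpa using exchange a₁ a₂ b₂ b₁ 0 q q 0 hpq (by omega) hq L hA
          (by simpa using hB)
    rcases Nat.eq_zero_or_pos q with rfl | hq
    · simpa using exchange a₂ a₁ b₁ b₂ 0 p p 0 (by omega) hpq hp L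
        (by simpa using hA) hB
    obtain ⟨p, rfl⟩ : ∃ p', p = p' + 1 := ⟨p - 1, by omega⟩
    obtain ⟨q, rfl⟩ : ∃ q', q = q' + 1 := ⟨q - 1, by omega⟩
    have split (a b : Fin n) : replicate (p + 1) a + replicate (q + 1) b =
        ({a} + {b}) + (replicate p a + replicate q b) := by
      rw [replicate_succ, replicate_succ, ← singleton_add, ← singleton_add]; abel
    rw [split] at hA hB ⊢
    rw [split]
    refine fiberTerm_sub_mem_of_exchange k e (by simp) (by simp) hA ?_ hB
      (ih (p + q) (by omega) a₁ a₂ b₁ b₂ p q p q rfl rfl)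
    intro x
    have h₁ := hA x
    have h₂ := hB x
    have s₁ := hsf a₁ x
    have s₂ := hsf a₂ x
    have s₃ := hsf b₁ x
    have s₄ := hsf b₂ x
    simp only [multisetExp_add, exp_singleton, exp_replicate, Finsupp.add_apply,
      Finsupp.smul_apply, smul_eq_mul] at h₁ h₂ ⊢
    interval_cases e a₁ x <;> interval_cases e a₂ x <;> interval_cases e b₁ x <;>
      interval_cases e b₂ x <;> omega
  · rw [← neg_sub]
    exact neg_mem (exchange b₁ b₂ a₁ a₂ u v p q huv hpq h L hB hA)

/-- If `α` takes at most `2` distinct values and `β` takes at most `2` distinct values,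
then `T_{α,β} ∈ span(J_1 ∪ J_2)`. -/
theorem Tab_mem_of_two_two
    (e : Fin n → (σ →₀ ℕ)) (hsf : ∀ i, SqFreeExp (e i))
    (hmin : ∀ i j : Fin n, i ≠ j →
      ¬ ((monomial (e i) (1 : k) : MvPolynomial σ k) ∣ monomial (e j) (1 : k)))
    {s : ℕ} (hs : 2 ≤ s) (α β : Fin s → Fin n)
    (a₁ a₂ b₁ b₂ : Fin n)
    (hα : ∀ i, α i = a₁ ∨ α i = a₂) (hβ : ∀ i, β i = b₁ ∨ β i = b₂) :
    Tab k e α β ∈ Ideal.span (Jset k e 1 ∪ Jset k e 2) := by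
  obtain ⟨p, q, hA⟩ := exists_eq_replicate_add_replicate
    (A := Finset.univ.val.map α) (a := a₁) (b := a₂) (by simpa using hα)
  obtain ⟨u, v, hB⟩ := exists_eq_replicate_add_replicate
    (A := Finset.univ.val.map β) (a := b₁) (b := b₂) (by simpa using hβ)
  have hpq : p + q = s := by simpa using (congrArg Multiset.card hA).symm
  have huv : u + v = s := by simpa using (congrArg Multiset.card hB).symm
  have hle_α : ∑ i, e (α i) ≤ (∑ i, e (α i)) ⊔ ∑ i, e (β i) := le_sup_left
  have hle_β : ∑ i, e (β i) ≤ (∑ i, e (α i)) ⊔ ∑ i, e (β i) := le_sup_right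
  have hTab := fiberTerm_sub_fiberTerm_eq_mul_Tab k e α β hle_α hle_β
  rw [tsub_self, monomial_zero', C_1, C_1, one_mul] at hTab
  rw [← hTab, hA, hB]
  exact fiberTerm_replicate_sub_mem k e hsf s a₁ a₂ b₁ b₂ p q u v hpq huv _
    (by rwa [← hA, multisetExp_map_univ]) (by rwa [← hB, multisetExp_map_univ])
end

section
/- Let n > 4, let R = k[y, x_2, …, x_{n-2}, z, u_2, …, u_{n-2}] be a polynomial ring over a field k, and let I = (f_1, …, f_n) where f_1 = (∏_{i=2}^{n-2} x_i)·z, f_i = x_i·y·(∏_{j=2, j≠i}^{n-2} u_j) for 2 ≤ i ≤ n−2, f_{n-1} = (∏_{i=2}^{n-2} x_i)·y, and f_n = (∏_{i=2}^{n-2} u_i)·z. Let F = T_1^{n-4}·∏_{i=2}^{n-2} T_i − T_{n-1}^{n-3}·T_n^{n-4} ∈ S. Then F ∈ ker φ, but F does not belong to the S-ideal generated by the elements of ker φ that are homogeneous of degree at most 2n−8 in the variables T_1,…,T_n. In particular the relation type of I is at least 2n−7. -/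
open MvPolynomial

/-- The variables `y, x_2, …, x_{n-2}, z, u_2, …, u_{n-2}` of the polynomial ring `R`:
`y = .inl (.inl ())`, `x_i = .inl (.inr _)`, `z = .inr (.inl ())`, `u_i = .inr (.inr _)`. -/
def exVar (n : ℕ) : Type := (Unit ⊕ Fin (n - 3)) ⊕ (Unit ⊕ Fin (n - 3))

/-- The generators `f_1, …, f_n` of the example: `f_1 = (∏ x_i) z`,
`f_i = x_i y (∏_{j ≠ i} u_j)` for `2 ≤ i ≤ n-2`, `f_{n-1} = (∏ x_i) y`, and
`f_n = (∏ u_i) z`.  (Indices are shifted down by one: `f_1` is `exGen k n 0`, etc.) -/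
noncomputable def exGen (k : Type*) [Field k] (n : ℕ) (i : Fin n) :
    MvPolynomial (exVar n) k :=
  if h0 : i.val = 0 then
    (∏ j : Fin (n - 3), X (Sum.inl (Sum.inr j))) * X (Sum.inr (Sum.inl ()))
  else if h1 : i.val = n - 2 then
    (∏ j : Fin (n - 3), X (Sum.inl (Sum.inr j))) * X (Sum.inl (Sum.inl ()))
  else if h2 : i.val = n - 1 then
    (∏ j : Fin (n - 3), X (Sum.inr (Sum.inr j))) * X (Sum.inr (Sum.inl ()))
  else
    X (Sum.inl (Sum.inr (⟨i.val - 1, by have := i.isLt; omega⟩ : Fin (n - 3)))) *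
      X (Sum.inl (Sum.inl ())) *
      ∏ j ∈ Finset.univ.erase (⟨i.val - 1, by have := i.isLt; omega⟩ : Fin (n - 3)),
        X (Sum.inr (Sum.inr j))

/-- The map `φ : S = R[T_1,…,T_n] → R[t]`, `T_i ↦ f_i t`, whose kernel is the defining
ideal of the Rees algebra of `I = (f_1, …, f_n)`. -/
noncomputable def exPhi (k : Type*) [Field k] (n : ℕ) :
    MvPolynomial (Fin n) (MvPolynomial (exVar n) k) →ₐ[MvPolynomial (exVar n) k]
      Polynomial (MvPolynomial (exVar n) k) :=
  aeval fun i => Polynomial.C (exGen k n i) * Polynomial.X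

/-- `F = T_1^{n-4} ∏_{i=2}^{n-2} T_i − T_{n-1}^{n-3} T_n^{n-4}`. -/
noncomputable def exF (k : Type*) [Field k] (n : ℕ) (hn : 4 < n) :
    MvPolynomial (Fin n) (MvPolynomial (exVar n) k) :=
  (X (⟨0, by omega⟩ : Fin n)) ^ (n - 4) *
      (∏ j : Fin (n - 3), X (⟨j.val + 1, by have := j.isLt; omega⟩ : Fin n))
    - (X (⟨n - 2, by omega⟩ : Fin n)) ^ (n - 3) * (X (⟨n - 1, by omega⟩ : Fin n)) ^ (n - 4)

/-- The variable `y`. -/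
def exY (n : ℕ) : exVar n := Sum.inl (Sum.inl ())

/-- The variables `x_{j+2}`. -/
def exX (n : ℕ) (j : Fin (n - 3)) : exVar n := Sum.inl (Sum.inr j)

/-- The variable `z`. -/
def exZ (n : ℕ) : exVar n := Sum.inr (Sum.inl ())

/-- The variables `u_{j+2}`. -/
def exU (n : ℕ) (j : Fin (n - 3)) : exVar n := Sum.inr (Sum.inr j)

lemma exVar_cases {n : ℕ} {P : exVar n → Prop} (hy : P (exY n)) (hx : ∀ j, P (exX n j))
    (hz : P (exZ n)) (hu : ∀ j, P (exU n j)) (v : exVar n) : P v :=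
  match v with
  | .inl (.inl ()) => hy
  | .inl (.inr j) => hx j
  | .inr (.inl ()) => hz
  | .inr (.inr j) => hu j

@[simp]
lemma exX_inj {n : ℕ} {i j : Fin (n - 3)} : exX n i = exX n j ↔ i = j :=
  (Sum.inl_injective.comp Sum.inr_injective).eq_iff

@[simp]
lemma exU_inj {n : ℕ} {i j : Fin (n - 3)} : exU n i = exU n j ↔ i = j :=
  (Sum.inr_injective.comp Sum.inr_injective).eq_iff

@[simp]
lemma exY_ne_exX {n : ℕ} (j : Fin (n - 3)) : exY n ≠ exX n j :=
  fun h => Sum.inl_ne_inr (Sum.inl_injective h)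

@[simp]
lemma exZ_ne_exU {n : ℕ} (j : Fin (n - 3)) : exZ n ≠ exU n j :=
  fun h => Sum.inl_ne_inr (Sum.inr_injective h)

@[simp]
lemma exY_ne_exZ (n : ℕ) : exY n ≠ exZ n := Sum.inl_ne_inr

@[simp]
lemma exY_ne_exU {n : ℕ} (j : Fin (n - 3)) : exY n ≠ exU n j := Sum.inl_ne_inr

@[simp]
lemma exX_ne_exZ {n : ℕ} (i : Fin (n - 3)) : exX n i ≠ exZ n := Sum.inl_ne_inr

@[simp]
lemma exX_ne_exU {n : ℕ} (i j : Fin (n - 3)) : exX n i ≠ exU n j := Sum.inl_ne_inr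

/-- The exponent vector of the monomial `exGen k n i`. -/
noncomputable def exExp (n : ℕ) (i : Fin n) : exVar n →₀ ℕ :=
  if h0 : i.val = 0 then
    (∑ j : Fin (n - 3), Finsupp.single (exX n j) 1) +
      Finsupp.single (exZ n) 1
  else if h1 : i.val = n - 2 then
    (∑ j : Fin (n - 3), Finsupp.single (exX n j) 1) +
      Finsupp.single (exY n) 1
  else if h2 : i.val = n - 1 then
    (∑ j : Fin (n - 3), Finsupp.single (exU n j) 1) +
      Finsupp.single (exZ n) 1
  else
    Finsupp.single (exX n (⟨i.val - 1, by have := i.isLt; omega⟩ : Fin (n - 3))) 1 +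
      Finsupp.single (exY n) 1 +
      ∑ j ∈ Finset.univ.erase (⟨i.val - 1, by have := i.isLt; omega⟩ : Fin (n - 3)),
        Finsupp.single (exU n j) 1

lemma exGen_eq_monomial (k : Type*) [Field k] (n : ℕ) (i : Fin n) :
    exGen k n i = monomial (exExp n i) 1 := by
  have h {a b : exVar n →₀ ℕ} :
      (monomial (a + b) 1 : MvPolynomial (exVar n) k) = monomial a 1 * monomial b 1 := by
    rw [monomial_mul, mul_one]
  unfold exGen exExp
  split_ifs <;> simp only [h, monomial_sum_one] <;> rfl

lemma degree_exExp (n : ℕ) (hn : 4 < n) (i : Fin n) : (exExp n i).degree = n - 2 := by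
  have := i.isLt
  unfold exExp
  split_ifs <;>
    simp only [map_add, map_sum, Finsupp.degree_single, Finset.sum_const, Finset.card_univ,
      Finset.card_erase_of_mem (Finset.mem_univ _), Fintype.card_fin, smul_eq_mul] <;> omega

/-- The index of the variable `T_{j+2}`, for `j < n - 3`. -/
def exMid (n : ℕ) (j : Fin (n - 3)) : Fin n := ⟨j.val + 1, by have := j.isLt; omega⟩

lemma prod_fin_eq_ends_mul_prod_exMid (n : ℕ) (hn : 4 < n) {A : Type*} [CommMonoid A]
    (g : Fin n → A) :
    ∏ i, g i = g ⟨0, by omega⟩ * (∏ j, g (exMid n j)) * g ⟨n - 2, by omega⟩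
      * g ⟨n - 1, by omega⟩ := by
  obtain ⟨m, rfl⟩ : ∃ m, n = m + 3 := ⟨n - 3, by omega⟩
  rw [Fin.prod_univ_castSucc, Fin.prod_univ_castSucc, Fin.prod_univ_succ]
  rfl

lemma sum_fin_eq_ends_add_sum_exMid (n : ℕ) (hn : 4 < n) {A : Type*} [AddCommMonoid A]
    (g : Fin n → A) :
    ∑ i, g i = g ⟨0, by omega⟩ + ∑ j, g (exMid n j) + g ⟨n - 2, by omega⟩
      + g ⟨n - 1, by omega⟩ :=
  prod_fin_eq_ends_mul_prod_exMid n hn (A := Multiplicative A) g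

lemma exExp_first (n : ℕ) (hn : 4 < n) : exExp n ⟨0, by omega⟩ =
    (∑ j : Fin (n - 3), Finsupp.single (exX n j) 1) +
      Finsupp.single (exZ n) 1 := by
  simp [exExp]

lemma exExp_penultimate (n : ℕ) (hn : 4 < n) : exExp n ⟨n - 2, by omega⟩ =
    (∑ j : Fin (n - 3), Finsupp.single (exX n j) 1) +
      Finsupp.single (exY n) 1 := by
  unfold exExp
  rw [dif_neg (by simp only; omega), dif_pos rfl]

lemma exExp_last (n : ℕ) (hn : 4 < n) : exExp n ⟨n - 1, by omega⟩ =
    (∑ j : Fin (n - 3), Finsupp.single (exU n j) 1) +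
      Finsupp.single (exZ n) 1 := by
  unfold exExp
  rw [dif_neg (by simp only; omega), dif_neg (by simp only; omega), dif_pos rfl]

lemma exExp_exMid (n : ℕ) (j : Fin (n - 3)) : exExp n (exMid n j) =
    Finsupp.single (exX n j) 1 + Finsupp.single (exY n) 1 +
      ∑ i ∈ Finset.univ.erase j, Finsupp.single (exU n i) 1 := by
  have := j.isLt
  unfold exExp exMid
  rw [dif_neg (by simp only; omega), dif_neg (by simp only; omega), dif_neg (by simp only; omega)]
  rfl

/-- The exponent vector of the image under `φ` of the monomial `T^M`, ignoring `t`. -/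
noncomputable def exExpSum (n : ℕ) (M : Fin n →₀ ℕ) : exVar n →₀ ℕ := ∑ i, M i • exExp n i

lemma prod_exGen_pow (k : Type*) [Field k] (n : ℕ) (M : Fin n →₀ ℕ) :
    ∏ i, exGen k n i ^ M i = monomial (exExpSum n M) 1 := by
  simp only [exGen_eq_monomial, monomial_pow, one_pow, exExpSum, monomial_sum_one]

lemma degree_exExpSum (n : ℕ) (hn : 4 < n) (M : Fin n →₀ ℕ) :
    (exExpSum n M).degree = M.degree * (n - 2) := by
  simp only [exExpSum, map_sum, map_nsmul, degree_exExp n hn, smul_eq_mul,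
    Finsupp.degree_eq_sum, Finset.sum_mul]

lemma exExpSum_y (n : ℕ) (hn : 4 < n) (M : Fin n →₀ ℕ) :
    exExpSum n M (exY n) = ∑ j, M (exMid n j) + M ⟨n - 2, by omega⟩ := by
  classical
  rw [exExpSum, Finsupp.finsetSum_apply, sum_fin_eq_ends_add_sum_exMid n hn]
  simp only [exExp_first n hn, exExp_penultimate n hn, exExp_last n hn, exExp_exMid]
  simp

lemma exExpSum_z (n : ℕ) (hn : 4 < n) (M : Fin n →₀ ℕ) :
    exExpSum n M (exZ n) = M ⟨0, by omega⟩ + M ⟨n - 1, by omega⟩ := by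
  classical
  rw [exExpSum, Finsupp.finsetSum_apply, sum_fin_eq_ends_add_sum_exMid n hn]
  simp only [exExp_first n hn, exExp_penultimate n hn, exExp_last n hn, exExp_exMid]
  simp

lemma exExpSum_x (n : ℕ) (hn : 4 < n) (M : Fin n →₀ ℕ) (j : Fin (n - 3)) :
    exExpSum n M (exX n j) =
      M ⟨0, by omega⟩ + M (exMid n j) + M ⟨n - 2, by omega⟩ := by
  classical
  rw [exExpSum, Finsupp.finsetSum_apply, sum_fin_eq_ends_add_sum_exMid n hn]
  simp only [exExp_first n hn, exExp_penultimate n hn, exExp_last n hn, exExp_exMid]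
  simp [Finsupp.single_apply]

lemma exExpSum_u_add (n : ℕ) (hn : 4 < n) (M : Fin n →₀ ℕ) (j : Fin (n - 3)) :
    exExpSum n M (exU n j) + M (exMid n j) =
      ∑ i, M (exMid n i) + M ⟨n - 1, by omega⟩ := by
  classical
  rw [exExpSum, Finsupp.finsetSum_apply, sum_fin_eq_ends_add_sum_exMid n hn]
  simp only [exExp_first n hn, exExp_penultimate n hn, exExp_last n hn, exExp_exMid]
  suffices h : (∑ i, if j = i then 0 else M (exMid n i)) + M ⟨n - 1, by omega⟩ + M (exMid n j) =
      ∑ i, M (exMid n i) + M ⟨n - 1, by omega⟩ by simpa [Finsupp.single_apply] using h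
  have h : M (exMid n j) = ∑ i, if j = i then M (exMid n i) else 0 := by simp
  rw [add_right_comm, h, ← Finset.sum_add_distrib]
  congr 1
  refine Finset.sum_congr rfl fun i _ => ?_
  split_ifs <;> simp

/-- The exponent vector of the leading monomial `T_1^{n-4} ∏ T_i` of `F`. -/
noncomputable def exLead (n : ℕ) (hn : 4 < n) : Fin n →₀ ℕ :=
  Finsupp.single ⟨0, by omega⟩ (n - 4) + ∑ j, Finsupp.single (exMid n j) 1

/-- The exponent vector of the trailing monomial `T_{n-1}^{n-3} T_n^{n-4}` of `F`. -/
noncomputable def exTrail (n : ℕ) (hn : 4 < n) : Fin n →₀ ℕ :=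
  Finsupp.single ⟨n - 2, by omega⟩ (n - 3) + Finsupp.single ⟨n - 1, by omega⟩ (n - 4)

lemma exF_eq (k : Type*) [Field k] (n : ℕ) (hn : 4 < n) :
    exF k n hn = monomial (exLead n hn) 1 - monomial (exTrail n hn) 1 := by
  have h {a b : Fin n →₀ ℕ} : (monomial (a + b) 1 :
      MvPolynomial (Fin n) (MvPolynomial (exVar n) k)) = monomial a 1 * monomial b 1 := by
    rw [monomial_mul, mul_one]
  simp only [exF, exLead, exTrail, h, monomial_sum_one, X_pow_eq_monomial]
  rfl

lemma exLead_first (n : ℕ) (hn : 4 < n) : exLead n hn ⟨0, by omega⟩ = n - 4 := by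
  simp [exLead, exMid]

lemma exLead_exMid (n : ℕ) (hn : 4 < n) (j : Fin (n - 3)) : exLead n hn (exMid n j) = 1 := by
  simp [exLead, exMid, Finsupp.single_apply, Fin.val_inj]

lemma exLead_penultimate (n : ℕ) (hn : 4 < n) : exLead n hn ⟨n - 2, by omega⟩ = 0 := by
  have (j : Fin (n - 3)) : j.val + 1 ≠ n - 2 := by omega
  have h : 0 ≠ n - 2 := by omega
  simp [exLead, exMid, this, h]

lemma exLead_last (n : ℕ) (hn : 4 < n) : exLead n hn ⟨n - 1, by omega⟩ = 0 := by
  have (j : Fin (n - 3)) : j.val + 1 ≠ n - 1 := by omega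
  have h : 0 ≠ n - 1 := by omega
  simp [exLead, exMid, this, h]

lemma exTrail_first (n : ℕ) (hn : 4 < n) : exTrail n hn ⟨0, by omega⟩ = 0 := by
  have h : n - 2 ≠ 0 := by omega
  have h' : n - 1 ≠ 0 := by omega
  simp [exTrail, h, h']

lemma exTrail_exMid (n : ℕ) (hn : 4 < n) (j : Fin (n - 3)) : exTrail n hn (exMid n j) = 0 := by
  have h : n - 2 ≠ j.val + 1 := by omega
  have h' : n - 1 ≠ j.val + 1 := by omega
  simp [exTrail, exMid, h, h']

lemma exTrail_penultimate (n : ℕ) (hn : 4 < n) : exTrail n hn ⟨n - 2, by omega⟩ = n - 3 := by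
  have h : n - 1 ≠ n - 2 := by omega
  simp [exTrail, h]

lemma exTrail_last (n : ℕ) (hn : 4 < n) : exTrail n hn ⟨n - 1, by omega⟩ = n - 4 := by
  have h : n - 2 ≠ n - 1 := by omega
  simp [exTrail, h]

lemma ext_exMid (n : ℕ) (hn : 4 < n) {M N : Fin n →₀ ℕ}
    (h0 : M ⟨0, by omega⟩ = N ⟨0, by omega⟩) (hmid : ∀ j, M (exMid n j) = N (exMid n j))
    (h1 : M ⟨n - 2, by omega⟩ = N ⟨n - 2, by omega⟩)
    (h2 : M ⟨n - 1, by omega⟩ = N ⟨n - 1, by omega⟩) : M = N := by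
  ext i
  by_cases hi0 : i.val = 0
  · rwa [show i = ⟨0, by omega⟩ from Fin.ext hi0]
  by_cases hi1 : i.val = n - 2
  · rwa [show i = ⟨n - 2, by omega⟩ from Fin.ext hi1]
  by_cases hi2 : i.val = n - 1
  · rwa [show i = ⟨n - 1, by omega⟩ from Fin.ext hi2]
  · rw [show i = exMid n ⟨i.val - 1, by omega⟩ from Fin.ext (by simp only [exMid]; omega)]
    exact hmid _

lemma degree_exLead (n : ℕ) (hn : 4 < n) : (exLead n hn).degree = 2 * n - 7 := by
  simp only [exLead, map_add, map_sum, Finsupp.degree_single, Finset.sum_const, Finset.card_univ,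
    Fintype.card_fin, smul_eq_mul]
  omega

lemma degree_exTrail (n : ℕ) (hn : 4 < n) : (exTrail n hn).degree = 2 * n - 7 := by
  simp only [exTrail, map_add, Finsupp.degree_single]
  omega

lemma exExpSum_exLead (n : ℕ) (hn : 4 < n) :
    exExpSum n (exLead n hn) = exExpSum n (exTrail n hn) := by
  have hs : ∑ j : Fin (n - 3), exLead n hn (exMid n j) = n - 3 := by simp [exLead_exMid]
  have ht : ∑ j : Fin (n - 3), exTrail n hn (exMid n j) = 0 := by simp [exTrail_exMid]
  ext v
  refine exVar_cases (P := fun v => exExpSum n (exLead n hn) v = exExpSum n (exTrail n hn) v)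
    ?_ (fun j => ?_) ?_ (fun j => ?_) v
  · rw [exExpSum_y n hn, exExpSum_y n hn, hs, ht, exLead_penultimate, exTrail_penultimate]
    omega
  · rw [exExpSum_x n hn, exExpSum_x n hn, exLead_first, exLead_exMid, exLead_penultimate,
      exTrail_first, exTrail_exMid, exTrail_penultimate]
    omega
  · rw [exExpSum_z n hn, exExpSum_z n hn, exLead_first, exLead_last, exTrail_first, exTrail_last]
    omega
  · have h1 := exExpSum_u_add n hn (exLead n hn) j
    have h2 := exExpSum_u_add n hn (exTrail n hn) j
    rw [hs, exLead_exMid, exLead_last] at h1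
    rw [ht, exTrail_exMid, exTrail_last] at h2
    omega

/-- A proper divisor of the leading monomial of `F` is determined by its image under `φ`. -/
lemma eq_of_exExpSum_eq (n : ℕ) (hn : 4 < n) {M N : Fin n →₀ ℕ} (hM : M ≤ exLead n hn)
    (hne : M ≠ exLead n hn) (h : exExpSum n N = exExpSum n M) : N = M := by
  have h0 := (hM ⟨0, by omega⟩).trans_eq (exLead_first n hn)
  have hmid (j) := (hM (exMid n j)).trans_eq (exLead_exMid n hn j)
  have hb := (hM ⟨n - 2, by omega⟩).trans_eq (exLead_penultimate n hn)
  have hc := (hM ⟨n - 1, by omega⟩).trans_eq (exLead_last n hn)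
  have hy := DFunLike.congr_fun h (exY n)
  have hz := DFunLike.congr_fun h (exZ n)
  have hx (j : Fin (n - 3)) := DFunLike.congr_fun h (exX n j)
  rw [exExpSum_y n hn, exExpSum_y n hn] at hy
  rw [exExpSum_z n hn, exExpSum_z n hn] at hz
  simp only [exExpSum_x n hn] at hx
  have hu (j : Fin (n - 3)) : ∑ i, N (exMid n i) + N ⟨n - 1, by omega⟩ + M (exMid n j) =
      ∑ i, M (exMid n i) + M ⟨n - 1, by omega⟩ + N (exMid n j) := by
    rw [← exExpSum_u_add n hn N j, ← exExpSum_u_add n hn M j, h]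
    ring
  have hsum : (n - 3) * (N ⟨0, by omega⟩ + N ⟨n - 2, by omega⟩) + ∑ j, N (exMid n j) =
      (n - 3) * (M ⟨0, by omega⟩ + M ⟨n - 2, by omega⟩) + ∑ j, M (exMid n j) := by
    have := Finset.sum_congr (rfl : (Finset.univ : Finset (Fin (n - 3))) = _) fun j _ => hx j
    simp only [Finset.sum_add_distrib, Finset.sum_const, Finset.card_univ, Fintype.card_fin,
      smul_eq_mul] at this
    linarith
  set A := M ⟨0, by omega⟩
  set B := M ⟨n - 2, by omega⟩
  set C := M ⟨n - 1, by omega⟩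
  set S := ∑ j, M (exMid n j)
  set A' := N ⟨0, by omega⟩
  set B' := N ⟨n - 2, by omega⟩
  set C' := N ⟨n - 1, by omega⟩
  set S' := ∑ j, N (exMid n j)
  obtain ⟨m, rfl⟩ : ∃ m, n = m + 3 := ⟨n - 3, by omega⟩
  simp only [Nat.add_sub_cancel] at hsum
  let j₀ : Fin (m + 3 - 3) := ⟨0, by omega⟩
  rcases lt_trichotomy (A + B) (A' + B') with hlt | heq | hgt
  · obtain ⟨e, he⟩ := Nat.exists_eq_add_of_lt hlt
    have hone (j) : M (exMid (m + 3) j) = 1 := by have := hx j; have := hmid j; omega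
    have he0 : e = 0 := by have := hx j₀; have := hmid j₀; omega
    subst he0
    refine absurd (ext_exMid _ hn ?_ (fun j => ?_) ?_ ?_) hne
    · rw [exLead_first]
      have := hx j₀
      have := hu j₀
      have : m + S' = S := by rw [he] at hsum; linarith
      change A = _
      omega
    · rw [exLead_exMid, hone]
    · rw [exLead_penultimate]; omega
    · rw [exLead_last]; omega
  · rw [heq] at hsum
    have := hx j₀
    have := hu j₀
    refine ext_exMid _ hn ?_ (fun j => ?_) ?_ ?_
    · change A' = A; omega
    · have := hx j; omega
    · change B' = B; omega
    · change C' = C; omega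
  · have : m * (A' + B') < m * (A + B) := Nat.mul_lt_mul_of_pos_left hgt (by omega)
    omega

lemma coeff_exPhi (k : Type*) [Field k] (n : ℕ)
    (p : MvPolynomial (Fin n) (MvPolynomial (exVar n) k)) (d : ℕ) :
    (exPhi k n p).coeff d =
      ∑ N ∈ p.support with N.degree = d, coeff N p * monomial (exExpSum n N) 1 := by
  rw [exPhi, aeval_def, eval₂_eq', Polynomial.finsetSum_coeff, Finset.sum_filter]
  refine Finset.sum_congr rfl fun N _ => ?_
  simp only [mul_pow, Finset.prod_mul_distrib, ← Polynomial.C_pow, Finset.prod_pow_eq_pow_sum,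
    ← map_prod, prod_exGen_pow, ← Finsupp.degree_eq_sum, Polynomial.algebraMap_eq,
    Polynomial.coeff_C_mul, Polynomial.coeff_X_pow]
  simp [eq_comm]

/-- The constant part of the coefficient of an element of `ker φ` at a proper divisor of the leading
monomial of `F` vanishes. -/
lemma constantCoeff_coeff_eq_zero_of_mem_ker (k : Type*) [Field k] (n : ℕ) (hn : 4 < n)
    {p : MvPolynomial (Fin n) (MvPolynomial (exVar n) k)} (hp : p ∈ RingHom.ker (exPhi k n))
    {M : Fin n →₀ ℕ} (hM : M ≤ exLead n hn) (hne : M ≠ exLead n hn) :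
    constantCoeff (coeff M p) = 0 := by
  classical
  by_cases hMp : M ∈ p.support
  swap
  · rw [notMem_support_iff.mp hMp, map_zero]
  have h := coeff_exPhi k n p M.degree
  rw [(RingHom.mem_ker).mp hp, Polynomial.coeff_zero] at h
  have h' := congrArg (coeff (exExpSum n M)) h
  rw [coeff_zero, coeff_sum, Finset.sum_eq_single M] at h'
  · rw [h', coeff_mul_monomial', if_pos le_rfl, tsub_self, mul_one, constantCoeff_eq]
  · intro N hN hNM
    rw [coeff_mul_monomial', if_neg]
    intro hle
    refine hNM (eq_of_exExpSum_eq n hn hM hne ?_)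
    obtain ⟨c, hc⟩ := exists_add_of_le hle
    have hdeg := congrArg Finsupp.degree hc
    rw [map_add, degree_exExpSum n hn, degree_exExpSum n hn, (Finset.mem_filter.mp hN).2,
      left_eq_add, Finsupp.degree_eq_zero_iff] at hdeg
    rw [hc, hdeg, add_zero]
  · intro hM'
    simp [mem_support_iff.mp hMp] at hM'

lemma constantCoeff_coeff_eq_zero_of_mem_span {σ R k : Type*} [CommRing R] [CommRing k]
    (f : R →+* k) {s : Set (MvPolynomial σ R)} {L : σ →₀ ℕ}
    (hs : ∀ p ∈ s, ∀ M ≤ L, f (coeff M p) = 0) {q : MvPolynomial σ R} (hq : q ∈ Ideal.span s) :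
    ∀ M ≤ L, f (coeff M q) = 0 := by
  classical
  induction hq using Submodule.span_induction with
  | mem p hp => exact hs p hp
  | zero => simp
  | add p q _ _ hp hq =>
    intro M hM
    rw [coeff_add, map_add, hp M hM, hq M hM, add_zero]
  | smul a p _ hp =>
    intro M hM
    rw [smul_eq_mul, coeff_mul, map_sum]
    refine Finset.sum_eq_zero fun x hx => ?_
    rw [map_mul, hp x.2 (le_trans ?_ hM), mul_zero]
    exact le_of_le_of_eq le_add_self (Finset.HasAntidiagonal.mem_antidiagonal.mp hx)

lemma exF_mem_ker (k : Type*) [Field k] (n : ℕ) (hn : 4 < n) :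
    exF k n hn ∈ RingHom.ker (exPhi k n) := by
  have key (M : Fin n →₀ ℕ) : exPhi k n (monomial M 1) =
      Polynomial.C (monomial (exExpSum n M) 1) * Polynomial.X ^ M.degree := by
    rw [exPhi, aeval_monomial, map_one, one_mul, Finsupp.prod_fintype _ _ (fun _ => pow_zero _)]
    simp only [mul_pow, Finset.prod_mul_distrib, ← Polynomial.C_pow, Finset.prod_pow_eq_pow_sum,
      ← map_prod, prod_exGen_pow, ← Finsupp.degree_eq_sum]
  rw [RingHom.mem_ker, exF_eq, map_sub, key, key, exExpSum_exLead, degree_exLead, degree_exTrail,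
    sub_self]

lemma exF_notMem_span (k : Type*) [Field k] (n : ℕ) (hn : 4 < n) :
    exF k n hn ∉ Ideal.span { p | p ∈ RingHom.ker (exPhi k n) ∧
      ∃ d ≤ 2 * n - 8, MvPolynomial.IsHomogeneous p d } := by
  classical
  intro hF
  have h := constantCoeff_coeff_eq_zero_of_mem_span constantCoeff (L := exLead n hn) ?_ hF
    (exLead n hn) le_rfl
  · have hne : exTrail n hn ≠ exLead n hn := fun h => by
      have := DFunLike.congr_fun h ⟨0, by omega⟩
      rw [exTrail_first, exLead_first] at this
      omega
    rw [exF_eq, coeff_sub, coeff_monomial, coeff_monomial, if_pos rfl, if_neg hne] at h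
    simp at h
  · rintro p ⟨hp, d, hd, hpd⟩ M hM
    by_cases hne : M = exLead n hn
    · rw [hpd.coeff_eq_zero, map_zero]
      rw [hne, degree_exLead]
      omega
    · exact constantCoeff_coeff_eq_zero_of_mem_ker k n hn hp hM hne

/-- `F ∈ ker φ`, but `F` is not in the `S`-ideal generated by the elements of `ker φ` that
are homogeneous of degree at most `2n − 8` in the `T`-variables.  In particular, the
relation type of `I` is at least `2n − 7`. -/
theorem exF_mem_ker_and_not_low_degree (k : Type*) [Field k] (n : ℕ) (hn : 4 < n) :
    exF k n hn ∈ RingHom.ker (exPhi k n) ∧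
    exF k n hn ∉ Ideal.span { p | p ∈ RingHom.ker (exPhi k n) ∧
      ∃ d ≤ 2 * n - 8, MvPolynomial.IsHomogeneous p d } ∧
    ∀ d : ℕ, RingHom.ker (exPhi k n) = Ideal.span { p | p ∈ RingHom.ker (exPhi k n) ∧
      ∃ i ≤ d, MvPolynomial.IsHomogeneous p i } → 2 * n - 7 ≤ d := by
  refine ⟨exF_mem_ker k n hn, exF_notMem_span k n hn, fun d hd => ?_⟩
  by_contra! hlt
  refine exF_notMem_span k n hn (Ideal.span_mono ?_ (hd ▸ exF_mem_ker k n hn))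
  rintro p ⟨hp, i, hi, hpi⟩
  exact ⟨hp, i, by omega, hpi⟩
end

section
/- Suppose I is generated by n ≤ 5 square-free monomials, and suppose there do NOT exist an integer s ≥ 2 and sequences α = (a_1, …, a_s), β = (b_1, …, b_1, b_2) : Fin s → Fin n with a_i ≠ b_1 and a_i ≠ b_2 for all i, such that: for every i there exists a variable x_i ∈ σ dividing f_{a_j} for all j ≠ i and dividing f_{b_1}, but dividing neither f_{a_i} nor f_{b_2}; and for every i there exists a variable z_i ∈ σ dividing both f_{a_i} and f_{b_2}, but dividing neither f_{a_j} for j ≠ i nor f_{b_1}. Then I is of linear type, i.e. ker φ = span(J_1). -/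
open MvPolynomial

variable (k : Type*) [Field k] {σ : Type*} {n : ℕ}

/-- Some variable divides `f_p` and `f_j` but neither `f_q` nor `f_j'`. -/
private def SepVar (e : Fin n → (σ →₀ ℕ)) (j j' p q : Fin n) : Prop :=
  ∃ x, e p x = 1 ∧ e j x = 1 ∧ e q x = 0 ∧ e j' x = 0

private def Separated (e : Fin n → (σ →₀ ℕ)) (j j' p q : Fin n) : Prop :=
  SepVar e j j' p q ∧ SepVar e j j' q p

private lemma exists_common_edge {V : Type*} [DecidableEq V] (A : Finset V) (hA : A.card ≤ 3)
    (hne : A.Nonempty) (G H : V → V → Prop) (hG : ∀ p q, G p q → G q p)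
    (hH : ∀ p q, H p q → H q p) (hGi : ∀ p, ¬ G p p) (hHi : ∀ p, ¬ H p p)
    (hGA : ∀ p ∈ A, ∃ q ∈ A, G p q) (hHA : ∀ p ∈ A, ∃ q ∈ A, H p q) :
    ∃ p ∈ A, ∃ q ∈ A, G p q ∧ H p q := by
  obtain ⟨i, hi⟩ := hne
  obtain ⟨p, hp, hip⟩ := hGA i hi
  obtain ⟨q, hq, hiq⟩ := hHA i hi
  by_cases hpq : p = q
  · subst hpq
    exact ⟨i, hi, p, hp, hip, hiq⟩
  have hpi : i ≠ p := fun h => hGi p (h ▸ hip)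
  have hqi : i ≠ q := fun h => hHi q (h ▸ hiq)
  have hAeq : ({i, p, q} : Finset V) = A := by
    apply Finset.eq_of_subset_of_card_le
    · intro z hz
      simp only [Finset.mem_insert, Finset.mem_singleton] at hz
      rcases hz with rfl | rfl | rfl <;> assumption
    · rw [Finset.card_eq_three.mpr ⟨i, p, q, hpi, hqi, hpq, rfl⟩]
      exact hA
  obtain ⟨r, hr, hpr⟩ := hHA p hp
  obtain ⟨t, ht, hqt⟩ := hGA q hq
  rw [← hAeq] at hr ht
  simp only [Finset.mem_insert, Finset.mem_singleton] at hr ht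
  rcases hr with rfl | rfl | rfl
  · exact ⟨_, hi, _, hp, hip, hH _ _ hpr⟩
  · exact absurd hpr (hHi _)
  rcases ht with rfl | rfl | rfl
  · exact ⟨_, hi, _, hq, hG _ _ hqt, hiq⟩
  · exact ⟨_, hp, _, hq, hG _ _ hqt, hpr⟩
  · exact absurd hqt (hGi _)

/-- If no exchange between the disjoint multisets `a` and `b` is possible at the pair `(i, j)`,
and `b` is supported on `{j, j'}`, then `i` is separated from another element of `a`. -/
private lemma exists_separated (e : Fin n → (σ →₀ ℕ)) (hsf : ∀ i, SqFreeExp (e i))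
    (a b : Fin n → ℕ) (hdeg : ∑ i, a i = ∑ i, b i) (j j' : Fin n) (hjj : j ≠ j')
    (hb : ∀ l, l ≠ j → l ≠ j' → b l = 0) (i : Fin n) (hi : a i ≠ 0)
    (hx : ∃ x, e j x = 1 ∧ e i x = 0 ∧ ∑ l, b l * e l x ≤ ∑ l, a l * e l x)
    (hy : ∃ y, e i y = 1 ∧ e j' y = 0 ∧ ∑ l, a l * e l y ≤ ∑ l, b l * e l y) :
    ∃ i', a i' ≠ 0 ∧ Separated e j j' i i' := by
  obtain ⟨x, hjx, hix, hx⟩ := hx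
  obtain ⟨y, hiy, hjy, hy⟩ := hy
  have hbsum (g : Fin n → ℕ) : ∑ l, b l * g l = b j * g j + b j' * g j' := by
    rw [← Finset.sum_pair hjj (f := fun l => b l * g l)]
    symm
    apply Finset.sum_subset (Finset.subset_univ _)
    intro l _ hl
    simp only [Finset.mem_insert, Finset.mem_singleton, not_or] at hl
    simp [hb l hl.1 hl.2]
  have hbs : ∑ l, b l = b j + b j' := by simpa using hbsum 1
  have hax : ∑ l, a l * e l x + a i ≤ ∑ l, a l := by
    rw [← Finset.add_sum_erase _ _ (Finset.mem_univ i),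
      ← Finset.add_sum_erase _ a (Finset.mem_univ i), hix, mul_zero, zero_add, add_comm]
    gcongr with l
    calc a l * e l x ≤ a l * 1 := Nat.mul_le_mul_left _ (hsf l x)
      _ = a l := mul_one _
  have hay : a i ≤ ∑ l, a l * e l y := by
    have := Finset.single_le_sum (f := fun l => a l * e l y) (fun _ _ => Nat.zero_le _)
      (Finset.mem_univ i)
    simpa [hiy] using this
  rw [hbsum] at hx hy
  have hj'x : e j' x = 0 := by
    have := hsf j' x
    by_contra h
    have h1 : e j' x = 1 := by omega
    rw [h1, hjx] at hx
    omega
  have hjy1 : e j y = 1 := by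
    have := hsf j y
    by_contra h
    have h1 : e j y = 0 := by omega
    rw [h1, hjy] at hy
    omega
  rw [hjx, hj'x] at hx
  rw [hjy1, hjy] at hy
  have hlt : ∃ i', a i' ≠ 0 ∧ e i' x = 1 ∧ e i' y = 0 := by
    by_contra! hcon
    have : ∑ l, a l * e l x < ∑ l, a l * e l y := by
      apply Finset.sum_lt_sum
      · intro l _
        by_cases hl : a l = 0
        · simp [hl]
        · apply Nat.mul_le_mul_left
          have h1 := hsf l x
          have h2 := hcon l hl
          omega
      · exact ⟨i, Finset.mem_univ i, by rw [hix, hiy]; omega⟩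
    omega
  obtain ⟨i', hi', h1, h2⟩ := hlt
  exact ⟨i', hi', ⟨y, hiy, hjy1, h2, hjy⟩, ⟨x, h1, hjx, hix, hj'x⟩⟩

/-- Multisets of the same size and disjoint supports between which no exchange is possible, the
second one having at most two distinct elements, yield an even cycle of length four. -/
private lemma exists_cycle_of_card_le_two (e : Fin n → (σ →₀ ℕ)) (hsf : ∀ i, SqFreeExp (e i))
    (hn : n ≤ 5) (a b : Fin n → ℕ) (hdeg : ∑ i, a i = ∑ i, b i) (ha : ∃ i, a i ≠ 0)
    (hdisj : ∀ i, a i = 0 ∨ b i = 0)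
    (hcard : (Finset.univ.filter fun j => b j ≠ 0).card ≤ 2)
    (hx : ∀ i j, a i ≠ 0 → b j ≠ 0 →
      ∃ x, e j x = 1 ∧ e i x = 0 ∧ ∑ l, b l * e l x ≤ ∑ l, a l * e l x)
    (hy : ∀ i j, a i ≠ 0 → b j ≠ 0 →
      ∃ y, e i y = 1 ∧ e j y = 0 ∧ ∑ l, a l * e l y ≤ ∑ l, b l * e l y) :
    ∃ p q j j', (a p ≠ 0 ∧ a q ≠ 0 ∧ b j ≠ 0 ∧ b j' ≠ 0) ∧
      Separated e j j' p q ∧ Separated e j' j p q := by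
  obtain ⟨i, hi⟩ := ha
  obtain ⟨j, hj⟩ : ∃ j, b j ≠ 0 := by
    by_contra! h
    have := Finset.single_le_sum (f := a) (fun _ _ => Nat.zero_le _) (Finset.mem_univ i)
    simp [hdeg, h] at this
    exact hi this
  obtain ⟨j', hj', hjj⟩ : ∃ j', b j' ≠ 0 ∧ j ≠ j' := by
    obtain ⟨y, hiy, hjy, hle⟩ := hy i j hi hj
    have h1 := Finset.single_le_sum (f := fun l => a l * e l y) (fun _ _ => Nat.zero_le _)
      (Finset.mem_univ i)
    simp only [hiy, mul_one] at h1
    have h2 : ∑ l, b l * e l y ≠ 0 := by omega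
    obtain ⟨j', -, hj'⟩ := Finset.exists_ne_zero_of_sum_ne_zero h2
    refine ⟨j', left_ne_zero_of_mul hj', ?_⟩
    rintro rfl
    simp [hjy] at hj'
  have hB : ({j, j'} : Finset (Fin n)) = Finset.univ.filter fun j => b j ≠ 0 := by
    apply Finset.eq_of_subset_of_card_le
    · intro z hz
      simp only [Finset.mem_insert, Finset.mem_singleton] at hz
      rcases hz with rfl | rfl <;> simpa
    · rwa [Finset.card_pair hjj]
  have hb (l : Fin n) (h1 : l ≠ j) (h2 : l ≠ j') : b l = 0 := by
    by_contra h
    have : l ∈ ({j, j'} : Finset (Fin n)) := by rw [hB]; simpa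
    simp [h1, h2] at this
  have hA : (Finset.univ.filter fun i => a i ≠ 0).card ≤ 3 := by
    have hd : Disjoint (Finset.univ.filter fun i => a i ≠ 0)
        (Finset.univ.filter fun j => b j ≠ 0) := by
      rw [Finset.disjoint_filter]
      intro l _ h
      simpa using (hdisj l).resolve_left h
    have h1 := Finset.card_le_univ
      ((Finset.univ.filter fun i => a i ≠ 0) ∪ Finset.univ.filter fun j => b j ≠ 0)
    rw [Finset.card_union_of_disjoint hd, ← hB, Finset.card_pair hjj, Fintype.card_fin] at h1
    omega
  have hirr (j j' p : Fin n) : ¬ Separated e j j' p p := by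
    rintro ⟨⟨x, h1, -, h2, -⟩, -⟩
    omega
  obtain ⟨p, hp, q, hq, h1, h2⟩ := exists_common_edge _ hA ⟨i, by simpa⟩
    (Separated e j j') (Separated e j' j) (fun _ _ h => h.symm) (fun _ _ h => h.symm)
    (hirr j j') (hirr j' j)
    (fun p hp => by
      have hp : a p ≠ 0 := by simpa using hp
      simpa using exists_separated e hsf a b hdeg j j' hjj hb p hp (hx p j hp hj)
        (hy p j' hp hj'))
    (fun p hp => by
      have hp : a p ≠ 0 := by simpa using hp
      simpa using exists_separated e hsf a b hdeg j' j hjj.symm (fun l h h' => hb l h' h) p hp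
        (hx p j' hp hj') (hy p j hp hj))
  exact ⟨p, q, j, j', ⟨by simpa using hp, by simpa using hq, hj, hj'⟩, h1, h2⟩

/-- Among at most five square-free monomials without an even cycle of length four, two products of
the same degree without common factor and with a common multiple admit an exchange. -/
private lemma exists_exchange (e : Fin n → (σ →₀ ℕ)) (hsf : ∀ i, SqFreeExp (e i)) (hn : n ≤ 5)
    (hcycle : ∀ p q j j', p ≠ j → p ≠ j' → q ≠ j → q ≠ j' →
      Separated e j j' p q → ¬ Separated e j' j p q)
    (a b : Fin n → ℕ) (hdeg : ∑ i, a i = ∑ i, b i) (ha : ∃ i, a i ≠ 0)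
    (hdisj : ∀ i, a i = 0 ∨ b i = 0) (u v : σ →₀ ℕ)
    (huv : u + ∑ i, a i • e i = v + ∑ i, b i • e i) :
    ∃ i j, a i ≠ 0 ∧ b j ≠ 0 ∧ (e j ≤ u + e i ∨ e i ≤ v + e j) := by
  by_contra! hcon
  have huv' (x : σ) : u x + ∑ i, a i * e i x = v x + ∑ i, b i * e i x := by
    simpa using DFunLike.congr_fun huv x
  have hx (i j : Fin n) (hi : a i ≠ 0) (hj : b j ≠ 0) :
      ∃ x, e j x = 1 ∧ e i x = 0 ∧ ∑ l, b l * e l x ≤ ∑ l, a l * e l x := by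
    have h := (hcon i j hi hj).1
    rw [Finsupp.le_def] at h
    push Not at h
    obtain ⟨x, h⟩ := h
    have h1 := hsf j x
    have h2 := huv' x
    simp only [Finsupp.add_apply] at h
    exact ⟨x, by omega, by omega, by omega⟩
  have hy (i j : Fin n) (hi : a i ≠ 0) (hj : b j ≠ 0) :
      ∃ y, e i y = 1 ∧ e j y = 0 ∧ ∑ l, a l * e l y ≤ ∑ l, b l * e l y := by
    have h := (hcon i j hi hj).2
    rw [Finsupp.le_def] at h
    push Not at h
    obtain ⟨x, h⟩ := h
    have h1 := hsf i x
    have h2 := huv' x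
    simp only [Finsupp.add_apply] at h
    exact ⟨x, by omega, by omega, by omega⟩
  have hne (i j : Fin n) (hi : a i ≠ 0) (hj : b j ≠ 0) : i ≠ j := by
    rintro rfl
    exact (hdisj i).elim hi hj
  have hd : Disjoint (Finset.univ.filter fun i => a i ≠ 0)
      (Finset.univ.filter fun j => b j ≠ 0) := by
    rw [Finset.disjoint_filter]
    intro l _ h
    simpa using (hdisj l).resolve_left h
  have h1 := Finset.card_le_univ
    ((Finset.univ.filter fun i => a i ≠ 0) ∪ Finset.univ.filter fun j => b j ≠ 0)
  rw [Finset.card_union_of_disjoint hd, Fintype.card_fin] at h1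
  by_cases hB : (Finset.univ.filter fun j => b j ≠ 0).card ≤ 2
  · obtain ⟨p, q, j, j', ⟨hp, hq, hj, hj'⟩, h1, h2⟩ :=
      exists_cycle_of_card_le_two e hsf hn a b hdeg ha hdisj hB hx hy
    exact hcycle p q j j' (hne _ _ hp hj) (hne _ _ hp hj') (hne _ _ hq hj) (hne _ _ hq hj') h1 h2
  · have hb : ∃ j, b j ≠ 0 := by
      have : 0 < (Finset.univ.filter fun j => b j ≠ 0).card := by omega
      obtain ⟨j, hj⟩ := Finset.card_pos.mp this
      exact ⟨j, by simpa using hj⟩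
    obtain ⟨p, q, j, j', ⟨hp, hq, hj, hj'⟩, h1, h2⟩ :=
      exists_cycle_of_card_le_two e hsf hn b a hdeg.symm hb (fun i => (hdisj i).symm) (by omega)
        (fun i j hi hj => hy j i hj hi) (fun i j hi hj => hx j i hj hi)
    exact hcycle p q j j' (hne _ _ hj hp).symm (hne _ _ hj' hp).symm (hne _ _ hj hq).symm
      (hne _ _ hj' hq).symm h1 h2

private lemma reesMap_monomial_s13 (e : Fin n → (σ →₀ ℕ)) (a : Fin n →₀ ℕ) (u : σ →₀ ℕ) (c : k) :
    reesMap k e (monomial a (monomial u c)) =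
      Polynomial.monomial (∑ i, a i) (monomial (u + ∑ i, a i • e i) c) := by
  rw [reesMap, aeval_monomial, Finsupp.prod_fintype _ _ (fun i => pow_zero _)]
  simp_rw [mul_pow, ← Polynomial.C_pow, Finset.prod_mul_distrib, Finset.prod_pow_eq_pow_sum,
    ← map_prod, monomial_pow, one_pow]
  rw [← monomial_sum_one, ← mul_assoc, Polynomial.algebraMap_eq, ← Polynomial.C_mul,
    monomial_mul, mul_one, Polynomial.C_mul_X_pow_eq_monomial]

private lemma Tab_one (e : Fin n → (σ →₀ ℕ)) (α β : Fin 1 → Fin n) :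
    Tab k e α β =
      monomial (Finsupp.single (α 0) 1) (monomial (e (β 0) - e (α 0) ⊓ e (β 0)) (1 : k)) -
      monomial (Finsupp.single (β 0) 1) (monomial (e (α 0) - e (α 0) ⊓ e (β 0)) (1 : k)) := by
  simp [Tab, expGcd, X, C_mul_monomial]

private lemma span_Jset_one_le_ker (e : Fin n → (σ →₀ ℕ)) :
    Ideal.span (Jset k e 1) ≤ RingHom.ker (reesMap k e) := by
  rw [Ideal.span_le]
  rintro _ ⟨α, β, rfl⟩
  have h : e (β 0) - e (α 0) ⊓ e (β 0) + e (α 0) = e (α 0) - e (α 0) ⊓ e (β 0) + e (β 0) := by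
    ext x
    simp only [Finsupp.add_apply, Finsupp.tsub_apply, Finsupp.inf_apply]
    omega
  simp [RingHom.mem_ker, Tab_one, reesMap_monomial_s13, Finsupp.single_apply, h]

private lemma exchange_mem_span (e : Fin n → (σ →₀ ℕ)) (a : Fin n →₀ ℕ) (i j : Fin n)
    (u v : σ →₀ ℕ) (h : u + e i = v + e j) :
    (monomial (a + Finsupp.single i 1) (monomial u (1 : k)) -
      monomial (a + Finsupp.single j 1) (monomial v (1 : k))) ∈ Ideal.span (Jset k e 1) := by
  have hx (x : σ) : u x + e i x = v x + e j x := DFunLike.congr_fun h x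
  have hu : u = (u - (e j - e i ⊓ e j)) + (e j - e i ⊓ e j) := by
    ext x
    have := hx x
    simp only [Finsupp.add_apply, Finsupp.tsub_apply, Finsupp.inf_apply]
    omega
  have hv : v = (u - (e j - e i ⊓ e j)) + (e i - e i ⊓ e j) := by
    ext x
    have := hx x
    simp only [Finsupp.add_apply, Finsupp.tsub_apply, Finsupp.inf_apply]
    omega
  have hmem : Tab k e (fun _ : Fin 1 => i) (fun _ => j) ∈ Ideal.span (Jset k e 1) :=
    Ideal.subset_span ⟨_, _, rfl⟩
  have := Ideal.mul_mem_left _ (monomial a (monomial (u - (e j - e i ⊓ e j)) (1 : k))) hmem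
  rwa [Tab_one, mul_sub, monomial_mul, monomial_mul, monomial_mul, monomial_mul, mul_one, ← hu,
    ← hv] at this

private lemma monomial_sub_mem_span (e : Fin n → (σ →₀ ℕ))
    (hex : ∀ (a b : Fin n → ℕ), ∑ i, a i = ∑ i, b i → (∃ i, a i ≠ 0) →
      (∀ i, a i = 0 ∨ b i = 0) → ∀ u v : σ →₀ ℕ,
      u + ∑ i, a i • e i = v + ∑ i, b i • e i →
      ∃ i j, a i ≠ 0 ∧ b j ≠ 0 ∧ (e j ≤ u + e i ∨ e i ≤ v + e j))
    (s : ℕ) : ∀ (a b : Fin n →₀ ℕ) (u v : σ →₀ ℕ), ∑ i, a i = s → ∑ i, b i = s →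
      u + ∑ i, a i • e i = v + ∑ i, b i • e i →
      (monomial a (monomial u (1 : k)) - monomial b (monomial v (1 : k))) ∈
        Ideal.span (Jset k e 1) := by
  have hsplit (a : Fin n →₀ ℕ) (i : Fin n) (hi : a i ≠ 0) :
      ∃ a', a = a' + Finsupp.single i 1 :=
    ⟨a - Finsupp.single i 1, (tsub_add_cancel_of_le (by
      rw [Finsupp.single_le_iff]; omega)).symm⟩
  have hsum (a : Fin n →₀ ℕ) (i : Fin n) :
      ∑ l, (a + Finsupp.single i 1 : Fin n →₀ ℕ) l = ∑ l, a l + 1 := by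
    simp [Finset.sum_add_distrib, Finsupp.single_apply]
  have hsmul (a : Fin n →₀ ℕ) (i : Fin n) :
      ∑ l, (a + Finsupp.single i 1 : Fin n →₀ ℕ) l • e l = ∑ l, a l • e l + e i := by
    simp [Finset.sum_add_distrib, add_smul, Finsupp.single_apply, ite_smul]
  induction s with
  | zero =>
    intro a b u v ha hb h
    have ha : a = 0 := by
      ext i
      simpa using (Finset.sum_eq_zero_iff.mp ha) i (Finset.mem_univ i)
    have hb : b = 0 := by
      ext i
      simpa using (Finset.sum_eq_zero_iff.mp hb) i (Finset.mem_univ i)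
    subst ha hb
    have : u = v := by simpa using h
    simp [this]
  | succ s ih =>
    have hcommon (a b : Fin n →₀ ℕ) (i : Fin n) (u v : σ →₀ ℕ)
        (ha : ∑ l, (a + Finsupp.single i 1 : Fin n →₀ ℕ) l = s + 1)
        (hb : ∑ l, (b + Finsupp.single i 1 : Fin n →₀ ℕ) l = s + 1)
        (h : u + ∑ l, (a + Finsupp.single i 1 : Fin n →₀ ℕ) l • e l =
          v + ∑ l, (b + Finsupp.single i 1 : Fin n →₀ ℕ) l • e l) :
        (monomial (a + Finsupp.single i 1) (monomial u (1 : k)) -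
          monomial (b + Finsupp.single i 1) (monomial v (1 : k))) ∈
          Ideal.span (Jset k e 1) := by
      rw [hsum] at ha hb
      rw [hsmul, hsmul, ← add_assoc, ← add_assoc] at h
      have := Ideal.mul_mem_right (X i) _
        (ih a b u v (by omega) (by omega) (add_right_cancel h))
      rwa [sub_mul, X, monomial_mul, monomial_mul, mul_one, mul_one] at this
    have hstep (a b : Fin n →₀ ℕ) (i j : Fin n) (u v : σ →₀ ℕ) (hle : e j ≤ u + e i)
        (ha : ∑ l, (a + Finsupp.single i 1 : Fin n →₀ ℕ) l = s + 1)
        (hb : ∑ l, (b + Finsupp.single j 1 : Fin n →₀ ℕ) l = s + 1)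
        (h : u + ∑ l, (a + Finsupp.single i 1 : Fin n →₀ ℕ) l • e l =
          v + ∑ l, (b + Finsupp.single j 1 : Fin n →₀ ℕ) l • e l) :
        (monomial (a + Finsupp.single i 1) (monomial u (1 : k)) -
          monomial (b + Finsupp.single j 1) (monomial v (1 : k))) ∈
          Ideal.span (Jset k e 1) := by
      have hu : u + e i = (u + e i - e j) + e j := (tsub_add_cancel_of_le hle).symm
      rw [← sub_add_sub_cancel _
        (monomial (a + Finsupp.single j 1) (monomial (u + e i - e j) (1 : k)))]
      refine add_mem (exchange_mem_span k e a i j _ _ hu) (hcommon a b j _ _ ?_ hb ?_)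
      · rw [hsum] at ha ⊢
        exact ha
      · rw [← h, hsmul, hsmul, ← add_assoc, ← add_assoc, add_right_comm, ← hu, add_right_comm]
    intro a b u v ha hb h
    by_cases hdisj : ∀ i, a i = 0 ∨ b i = 0
    · have hane : ∃ i, a i ≠ 0 := by
        by_contra! h0
        simp [h0] at ha
      obtain ⟨i, j, hi, hj, hle⟩ := hex a b (ha.trans hb.symm) hane hdisj u v h
      obtain ⟨a, rfl⟩ := hsplit a i hi
      obtain ⟨b, rfl⟩ := hsplit b j hj
      rcases hle with hle | hle
      · exact hstep a b i j u v hle ha hb h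
      · rw [← neg_sub]
        exact neg_mem (hstep b a j i v u hle hb ha h.symm)
    · push Not at hdisj
      obtain ⟨i, hi, hj⟩ := hdisj
      obtain ⟨a, rfl⟩ := hsplit a i hi
      obtain ⟨b, rfl⟩ := hsplit b i hj
      exact hcommon a b i u v ha hb h

/-- An ideal containing all differences of monomials with the same image contains the kernel. -/
private lemma ker_le_of_monomial_sub_mem (e : Fin n → (σ →₀ ℕ))
    (J : Ideal (MvPolynomial (Fin n) (MvPolynomial σ k)))
    (hJ : ∀ (a b : Fin n →₀ ℕ) (u v : σ →₀ ℕ), ∑ i, a i = ∑ i, b i →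
      u + ∑ i, a i • e i = v + ∑ i, b i • e i →
      (monomial a (monomial u (1 : k)) - monomial b (monomial v (1 : k))) ∈ J) :
    RingHom.ker (reesMap k e) ≤ J := by
  classical
  let g (s : ℕ) (w : σ →₀ ℕ) : MvPolynomial (Fin n) (MvPolynomial σ k) ⧸ J :=
    if h : ∃ p : (Fin n →₀ ℕ) × (σ →₀ ℕ), ∑ i, p.1 i = s ∧ p.2 + ∑ i, p.1 i • e i = w then
      Ideal.Quotient.mk J (monomial h.choose.1 (monomial h.choose.2 (1 : k)))
    else 0
  have hg (a : Fin n →₀ ℕ) (u : σ →₀ ℕ) : g (∑ i, a i) (u + ∑ i, a i • e i) =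
      Ideal.Quotient.mk J (monomial a (monomial u (1 : k))) := by
    have h : ∃ p : (Fin n →₀ ℕ) × (σ →₀ ℕ), ∑ i, p.1 i = ∑ i, a i ∧
        p.2 + ∑ i, p.1 i • e i = u + ∑ i, a i • e i := ⟨(a, u), rfl, rfl⟩
    simp only [g, dif_pos h]
    exact Ideal.Quotient.eq.mpr (hJ _ _ _ _ h.choose_spec.1 h.choose_spec.2)
  let ψ : Polynomial (MvPolynomial σ k) →ₗ[k] MvPolynomial (Fin n) (MvPolynomial σ k) ⧸ J :=
    Polynomial.lsum fun s => (basisMonomials σ k).constr k (g s)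
  have hψ (s : ℕ) (w : σ →₀ ℕ) (c : k) :
      ψ (Polynomial.monomial s (monomial w c)) = c • g s w := by
    have h : (monomial w c : MvPolynomial σ k) = c • basisMonomials σ k w := by
      simp [smul_monomial]
    simp only [ψ, Polynomial.lsum_apply]
    rw [Polynomial.sum_monomial_index _
      (fun s r => (basisMonomials σ k).constr k (g s) r) (map_zero _), h, map_smul, Module.Basis.constr_basis]
  have hcomp (p : MvPolynomial (Fin n) (MvPolynomial σ k)) :
      ψ (reesMap k e p) = Ideal.Quotient.mk J p := by
    induction p using MvPolynomial.induction_on' with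
    | monomial a r =>
      induction r using MvPolynomial.induction_on' with
      | monomial u c =>
        rw [reesMap_monomial_s13, hψ, hg, ← Ideal.Quotient.mkₐ_eq_mk k, ← map_smul, smul_monomial,
          smul_monomial, smul_eq_mul, mul_one]
      | add p q hp hq => rw [map_add, map_add, map_add, hp, hq, map_add]
    | add p q hp hq => rw [map_add, map_add, hp, hq, map_add]
  intro p hp
  rw [← Ideal.Quotient.eq_zero_iff_mem, ← hcomp, (RingHom.mem_ker).mp hp, map_zero]

/-- Suppose `I` is generated by `n ≤ 5` square-free monomials, and there do NOT exist
`s ≥ 2` and sequences `α = (a_1,…,a_s)`, `β = (b_1,…,b_1,b_2)` with `a_i ≠ b_1, b_2` for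
all `i` such that: for every `i` there is a variable `x_i` dividing `f_{a_j}` for all
`j ≠ i` and dividing `f_{b_1}` but dividing neither `f_{a_i}` nor `f_{b_2}`; and for
every `i` there is a variable `z_i` dividing both `f_{a_i}` and `f_{b_2}` but dividing
neither `f_{a_j}` for `j ≠ i` nor `f_{b_1}`.  Then `I` is of linear type:
`ker φ = span(J_1)`. -/
theorem linear_type_of_card_le_five
    (e : Fin n → (σ →₀ ℕ)) (hsf : ∀ i, SqFreeExp (e i))
    (hmin : ∀ i j : Fin n, i ≠ j →
      ¬ ((monomial (e i) (1 : k) : MvPolynomial σ k) ∣ monomial (e j) (1 : k)))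
    (hn : n ≤ 5)
    (hno : ¬ ∃ (s : ℕ) (_ : 2 ≤ s) (α : Fin s → Fin n) (b₁ b₂ : Fin n),
      (∀ i, α i ≠ b₁ ∧ α i ≠ b₂) ∧
      (∀ i : Fin s, ∃ x : σ, (∀ j : Fin s, j ≠ i → 1 ≤ e (α j) x) ∧
        1 ≤ e b₁ x ∧ e (α i) x = 0 ∧ e b₂ x = 0) ∧
      (∀ i : Fin s, ∃ z : σ, 1 ≤ e (α i) z ∧ 1 ≤ e b₂ z ∧
        (∀ j : Fin s, j ≠ i → e (α j) z = 0) ∧ e b₁ z = 0)) :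
    RingHom.ker (reesMap k e) = Ideal.span (Jset k e 1) := by
  refine le_antisymm (ker_le_of_monomial_sub_mem k e _ fun a b u v hab h =>
    monomial_sub_mem_span k e (exists_exchange e hsf hn ?_) _ a b u v hab rfl h)
    (span_Jset_one_le_ker k e)
  rintro p q j j' hpj hpj' hqj hqj' ⟨⟨x, hx⟩, ⟨y, hy⟩⟩ ⟨⟨z, hz⟩, ⟨w, hw⟩⟩
  refine hno ⟨2, le_rfl, ![p, q], j, j', ?_, ?_, ?_⟩ <;>
    simp only [Fin.forall_fin_two, Matrix.cons_val_zero, Matrix.cons_val_one]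
  · exact ⟨⟨hpj, hpj'⟩, hqj, hqj'⟩
  · exact ⟨⟨y, by simp; omega⟩, ⟨x, by simp; omega⟩⟩
  · exact ⟨⟨z, by simp; omega⟩, ⟨w, by simp; omega⟩⟩
end

section
/- Let R = k[x_1,…,x_7] over a field k and let I = (f_1, f_2, f_3, f_4) with f_1 = x_1x_2x_3, f_2 = x_2x_4x_5, f_3 = x_5x_6x_7, f_4 = x_3x_6x_7. Then the defining ideal of the Rees algebra of I is generated by the five binomials x_3T_3 − x_5T_4, x_6x_7T_1 − x_1x_2T_4, x_6x_7T_2 − x_2x_4T_3, x_4x_5T_1 − x_1x_3T_2, and x_4T_1T_3 − x_1T_2T_4; that is, ker φ equals the S-ideal generated by these five elements. -/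
open MvPolynomial

/-- The generators `f_1 = x_1x_2x_3`, `f_2 = x_2x_4x_5`, `f_3 = x_5x_6x_7`,
`f_4 = x_3x_6x_7` in `R = k[x_1,…,x_7]` (with `x_i` the variable `X (i-1) : Fin 7`). -/
noncomputable def villarrealGen (k : Type*) [Field k] : Fin 4 → MvPolynomial (Fin 7) k :=
  ![X 0 * X 1 * X 2, X 1 * X 3 * X 4, X 4 * X 5 * X 6, X 2 * X 5 * X 6]

/-- The map `φ : S = R[T_1,…,T_4] → R[t]`, `T_i ↦ f_i t`, whose kernel is the defining
ideal of the Rees algebra of `I = (f_1, f_2, f_3, f_4)` (with `T_i` the variable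
`X (i-1) : Fin 4`). -/
noncomputable def villarrealPhi (k : Type*) [Field k] :
    MvPolynomial (Fin 4) (MvPolynomial (Fin 7) k) →ₐ[MvPolynomial (Fin 7) k]
      Polynomial (MvPolynomial (Fin 7) k) :=
  aeval fun i => Polynomial.C (villarrealGen k i) * Polynomial.X

/-- A linear map sending basis vectors to basis vectors has its kernel contained in any
submodule that contains the differences of basis vectors with equal image. -/
theorem LinearMap.ker_le_of_basis_of_sub_mem {A V W ι κ : Type*} [CommRing A]
    [AddCommGroup V] [Module A V] [AddCommGroup W] [Module A W]
    (B : Module.Basis ι A V) (D : Module.Basis κ A W) (g : ι → κ) (f : V →ₗ[A] W)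
    (hf : ∀ i, f (B i) = D (g i)) (J : Submodule A V)
    (hJ : ∀ i j, g i = g j → B i - B j ∈ J) : LinearMap.ker f ≤ J := by
  classical
  let s : W →ₗ[A] V ⧸ J := D.constr A fun c =>
    if h : ∃ i, g i = c then J.mkQ (B h.choose) else 0
  have hs : s ∘ₗ f = J.mkQ := by
    refine B.ext fun i => ?_
    have h : ∃ j, g j = g i := ⟨i, rfl⟩
    simp only [LinearMap.comp_apply, hf, s, Module.Basis.constr_basis, dif_pos h]
    exact (Submodule.Quotient.eq J).2 (hJ _ _ h.choose_spec)
  intro v hv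
  rw [← Submodule.ker_mkQ J, ← hs, LinearMap.mem_ker, LinearMap.comp_apply,
    LinearMap.mem_ker.1 hv, map_zero]

/-- The five binomial relations, imposed on elements of a commutative monoid. -/
structure VillarrealRel {M : Type*} [CommMonoid M] (x : Fin 7 → M) (T : Fin 4 → M) : Prop where
  rel_three_four : x 2 * T 2 = x 4 * T 3
  rel_one_four : x 5 * x 6 * T 0 = x 0 * x 1 * T 3
  rel_two_three : x 5 * x 6 * T 1 = x 1 * x 3 * T 2
  rel_one_two : x 3 * x 4 * T 0 = x 0 * x 2 * T 1
  rel_square : x 3 * (T 0 * T 2) = x 0 * (T 1 * T 3)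

/-- The monomial in `x` and `T` with the given exponents. -/
def villarrealMonomial {M : Type*} [CommMonoid M] (x : Fin 7 → M) (T : Fin 4 → M)
    (a₁ a₂ a₃ a₄ a₅ a₆ a₇ b₁ b₂ b₃ b₄ : ℕ) : M :=
  x 0 ^ a₁ * x 1 ^ a₂ * x 2 ^ a₃ * x 3 ^ a₄ * x 4 ^ a₅ * x 5 ^ a₆ * x 6 ^ a₇ *
    (T 0 ^ b₁ * T 1 ^ b₂ * T 2 ^ b₃ * T 3 ^ b₄)

namespace VillarrealRel

variable {M : Type*} [CommMonoid M] {x : Fin 7 → M} {T : Fin 4 → M}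

theorem rel_one_three (h : VillarrealRel x T) :
    x 0 * x 1 * x 2 * T 2 = x 4 * x 5 * x 6 * T 0 := by
  calc x 0 * x 1 * x 2 * T 2 = x 0 * x 1 * (x 2 * T 2) := by ac_rfl
    _ = x 4 * (x 0 * x 1 * T 3) := by rw [h.rel_three_four]; ac_rfl
    _ = x 4 * x 5 * x 6 * T 0 := by rw [← h.rel_one_four]; ac_rfl

theorem rel_two_four (h : VillarrealRel x T) :
    x 1 * x 3 * x 4 * T 3 = x 2 * x 5 * x 6 * T 1 := by
  calc x 1 * x 3 * x 4 * T 3 = x 1 * x 3 * (x 4 * T 3) := by ac_rfl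
    _ = x 2 * (x 1 * x 3 * T 2) := by rw [← h.rel_three_four]; ac_rfl
    _ = x 2 * x 5 * x 6 * T 1 := by rw [← h.rel_two_three]; ac_rfl

theorem move_one_two (h : VillarrealRel x T) (a₁ a₂ a₃ a₄ a₅ a₆ a₇ b₁ b₂ b₃ b₄ : ℕ) :
    villarrealMonomial x T (a₁ + 1) a₂ (a₃ + 1) a₄ a₅ a₆ a₇ b₁ (b₂ + 1) b₃ b₄ =
      villarrealMonomial x T a₁ a₂ a₃ (a₄ + 1) (a₅ + 1) a₆ a₇ (b₁ + 1) b₂ b₃ b₄ := by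
  have key := congrArg (villarrealMonomial x T a₁ a₂ a₃ a₄ a₅ a₆ a₇ b₁ b₂ b₃ b₄ * ·)
    h.rel_one_two.symm
  simp only [villarrealMonomial, pow_succ] at key ⊢
  convert key using 1 <;> ac_rfl

theorem move_two_three (h : VillarrealRel x T) (a₁ a₂ a₃ a₄ a₅ a₆ a₇ b₁ b₂ b₃ b₄ : ℕ) :
    villarrealMonomial x T a₁ (a₂ + 1) a₃ (a₄ + 1) a₅ a₆ a₇ b₁ b₂ (b₃ + 1) b₄ =
      villarrealMonomial x T a₁ a₂ a₃ a₄ a₅ (a₆ + 1) (a₇ + 1) b₁ (b₂ + 1) b₃ b₄ := by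
  have key := congrArg (villarrealMonomial x T a₁ a₂ a₃ a₄ a₅ a₆ a₇ b₁ b₂ b₃ b₄ * ·)
    h.rel_two_three.symm
  simp only [villarrealMonomial, pow_succ] at key ⊢
  convert key using 1 <;> ac_rfl

theorem move_three_four (h : VillarrealRel x T) (a₁ a₂ a₃ a₄ a₅ a₆ a₇ b₁ b₂ b₃ b₄ : ℕ) :
    villarrealMonomial x T a₁ a₂ a₃ a₄ (a₅ + 1) a₆ a₇ b₁ b₂ b₃ (b₄ + 1) =
      villarrealMonomial x T a₁ a₂ (a₃ + 1) a₄ a₅ a₆ a₇ b₁ b₂ (b₃ + 1) b₄ := by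
  have key := congrArg (villarrealMonomial x T a₁ a₂ a₃ a₄ a₅ a₆ a₇ b₁ b₂ b₃ b₄ * ·)
    h.rel_three_four.symm
  simp only [villarrealMonomial, pow_succ] at key ⊢
  convert key using 1 <;> ac_rfl

theorem move_four_one (h : VillarrealRel x T) (a₁ a₂ a₃ a₄ a₅ a₆ a₇ b₁ b₂ b₃ b₄ : ℕ) :
    villarrealMonomial x T a₁ a₂ a₃ a₄ a₅ (a₆ + 1) (a₇ + 1) (b₁ + 1) b₂ b₃ b₄ =
      villarrealMonomial x T (a₁ + 1) (a₂ + 1) a₃ a₄ a₅ a₆ a₇ b₁ b₂ b₃ (b₄ + 1) := by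
  have key := congrArg (villarrealMonomial x T a₁ a₂ a₃ a₄ a₅ a₆ a₇ b₁ b₂ b₃ b₄ * ·)
    h.rel_one_four
  simp only [villarrealMonomial, pow_succ] at key ⊢
  convert key using 1 <;> ac_rfl

theorem move_one_three (h : VillarrealRel x T) (a₁ a₂ a₃ a₄ a₅ a₆ a₇ b₁ b₂ b₃ b₄ : ℕ) :
    villarrealMonomial x T (a₁ + 1) (a₂ + 1) (a₃ + 1) a₄ a₅ a₆ a₇ b₁ b₂ (b₃ + 1) b₄ =
      villarrealMonomial x T a₁ a₂ a₃ a₄ (a₅ + 1) (a₆ + 1) (a₇ + 1) (b₁ + 1) b₂ b₃ b₄ := by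
  have key := congrArg (villarrealMonomial x T a₁ a₂ a₃ a₄ a₅ a₆ a₇ b₁ b₂ b₃ b₄ * ·)
    h.rel_one_three
  simp only [villarrealMonomial, pow_succ] at key ⊢
  convert key using 1 <;> ac_rfl

theorem move_two_four (h : VillarrealRel x T) (a₁ a₂ a₃ a₄ a₅ a₆ a₇ b₁ b₂ b₃ b₄ : ℕ) :
    villarrealMonomial x T a₁ (a₂ + 1) a₃ (a₄ + 1) (a₅ + 1) a₆ a₇ b₁ b₂ b₃ (b₄ + 1) =
      villarrealMonomial x T a₁ a₂ (a₃ + 1) a₄ a₅ (a₆ + 1) (a₇ + 1) b₁ (b₂ + 1) b₃ b₄ := by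
  have key := congrArg (villarrealMonomial x T a₁ a₂ a₃ a₄ a₅ a₆ a₇ b₁ b₂ b₃ b₄ * ·)
    h.rel_two_four
  simp only [villarrealMonomial, pow_succ] at key ⊢
  convert key using 1 <;> ac_rfl

theorem move_square (h : VillarrealRel x T) (a₁ a₂ a₃ a₄ a₅ a₆ a₇ b₁ b₂ b₃ b₄ : ℕ) :
    villarrealMonomial x T (a₁ + 1) a₂ a₃ a₄ a₅ a₆ a₇ b₁ (b₂ + 1) b₃ (b₄ + 1) =
      villarrealMonomial x T a₁ a₂ a₃ (a₄ + 1) a₅ a₆ a₇ (b₁ + 1) b₂ (b₃ + 1) b₄ := by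
  have key := congrArg (villarrealMonomial x T a₁ a₂ a₃ a₄ a₅ a₆ a₇ b₁ b₂ b₃ b₄ * ·)
    h.rel_square.symm
  simp only [villarrealMonomial, pow_succ] at key ⊢
  convert key using 1 <;> ac_rfl

set_option maxHeartbeats 4000000 in
/-- The combinatorial core: two distinct exponent vectors in a fibre can be brought closer to
each other by applying one of the moves to one of them. -/
theorem exists_move {b₁ b₂ b₃ b₄ b₁' b₂' b₃' b₄' : ℕ}
    (hb : b₁ + b₂ + b₃ + b₄ = b₁' + b₂' + b₃' + b₄') :
    (b₁ = b₁' ∧ b₂ = b₂' ∧ b₃ = b₃' ∧ b₄ = b₄') ∨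
    ((b₁ < b₁' ∧ b₂' < b₂ ∧ b₁ + b₄ < b₁' + b₄') ∨
      (b₂ < b₂' ∧ b₃' < b₃ ∧ b₁ + b₂ < b₁' + b₂') ∨
      (b₃ < b₃' ∧ b₄' < b₄ ∧ b₂ + b₃ < b₂' + b₃') ∨
      (b₄ < b₄' ∧ b₁' < b₁ ∧ b₃ + b₄ < b₃' + b₄') ∨
      (b₁ < b₁' ∧ b₃' < b₃ ∧ b₁ + b₂ < b₁' + b₂' ∧ b₁ + b₄ < b₁' + b₄') ∨
      (b₂ < b₂' ∧ b₄' < b₄ ∧ b₁ + b₂ < b₁' + b₂' ∧ b₂ + b₃ < b₂' + b₃') ∨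
      (b₁ < b₁' ∧ b₂' < b₂ ∧ b₃ < b₃' ∧ b₄' < b₄)) ∨
    ((b₁' < b₁ ∧ b₂ < b₂' ∧ b₁' + b₄' < b₁ + b₄) ∨
      (b₂' < b₂ ∧ b₃ < b₃' ∧ b₁' + b₂' < b₁ + b₂) ∨
      (b₃' < b₃ ∧ b₄ < b₄' ∧ b₂' + b₃' < b₂ + b₃) ∨
      (b₄' < b₄ ∧ b₁ < b₁' ∧ b₃' + b₄' < b₃ + b₄) ∨
      (b₁' < b₁ ∧ b₃ < b₃' ∧ b₁' + b₂' < b₁ + b₂ ∧ b₁' + b₄' < b₁ + b₄) ∨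
      (b₂' < b₂ ∧ b₄ < b₄' ∧ b₁' + b₂' < b₁ + b₂ ∧ b₂' + b₃' < b₂ + b₃) ∨
      (b₁' < b₁ ∧ b₂ < b₂' ∧ b₃' < b₃ ∧ b₄ < b₄')) := by
  rcases lt_trichotomy b₁ b₁' with h₁ | h₁ | h₁ <;>
  rcases lt_trichotomy b₂ b₂' with h₂ | h₂ | h₂ <;>
  rcases lt_trichotomy b₃ b₃' with h₃ | h₃ | h₃ <;>
  rcases lt_trichotomy b₄ b₄' with h₄ | h₄ | h₄ <;>
  first
    | (exfalso; omega)
    | exact .inl (by omega)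
    | exact .inr <| .inl <| .inl ⟨‹_›, ‹_›, by omega⟩
    | exact .inr <| .inl <| .inr <| .inl ⟨‹_›, ‹_›, by omega⟩
    | exact .inr <| .inl <| .inr <| .inr <| .inl ⟨‹_›, ‹_›, by omega⟩
    | exact .inr <| .inl <| .inr <| .inr <| .inr <| .inl ⟨‹_›, ‹_›, by omega⟩
    | exact .inr <| .inl <| .inr <| .inr <| .inr <| .inr <| .inl ⟨‹_›, ‹_›, by omega, by omega⟩
    | exact .inr <| .inl <| .inr <| .inr <| .inr <| .inr <| .inr <| .inl
        ⟨‹_›, ‹_›, by omega, by omega⟩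
    | exact .inr <| .inl <| .inr <| .inr <| .inr <| .inr <| .inr <| .inr <| ⟨‹_›, ‹_›, ‹_›, ‹_›⟩
    | exact .inr <| .inr <| .inl ⟨‹_›, ‹_›, by omega⟩
    | exact .inr <| .inr <| .inr <| .inl ⟨‹_›, ‹_›, by omega⟩
    | exact .inr <| .inr <| .inr <| .inr <| .inl ⟨‹_›, ‹_›, by omega⟩
    | exact .inr <| .inr <| .inr <| .inr <| .inr <| .inl ⟨‹_›, ‹_›, by omega⟩
    | exact .inr <| .inr <| .inr <| .inr <| .inr <| .inr <| .inl ⟨‹_›, ‹_›, by omega, by omega⟩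
    | exact .inr <| .inr <| .inr <| .inr <| .inr <| .inr <| .inr <| .inl
        ⟨‹_›, ‹_›, by omega, by omega⟩
    | exact .inr <| .inr <| .inr <| .inr <| .inr <| .inr <| .inr <| .inr <| ⟨‹_›, ‹_›, ‹_›, ‹_›⟩

set_option maxHeartbeats 4000000 in
/-- Monomials with the same image under `φ` agree modulo the five relations. -/
theorem monomial_eq (h : VillarrealRel x T) (n : ℕ) :
    ∀ {a₁ a₂ a₃ a₄ a₅ a₆ a₇ b₁ b₂ b₃ b₄
      a₁' a₂' a₃' a₄' a₅' a₆' a₇' b₁' b₂' b₃' b₄' : ℕ},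
    a₁ + b₁ = a₁' + b₁' →
    a₂ + b₁ + b₂ = a₂' + b₁' + b₂' →
    a₃ + b₁ + b₄ = a₃' + b₁' + b₄' →
    a₄ + b₂ = a₄' + b₂' →
    a₅ + b₂ + b₃ = a₅' + b₂' + b₃' →
    a₆ + b₃ + b₄ = a₆' + b₃' + b₄' →
    a₇ + b₃ + b₄ = a₇' + b₃' + b₄' →
    b₁ + b₂ + b₃ + b₄ = b₁' + b₂' + b₃' + b₄' →
    b₁' - b₁ + (b₂' - b₂) + (b₃' - b₃) + (b₄' - b₄) ≤ n →
    villarrealMonomial x T a₁ a₂ a₃ a₄ a₅ a₆ a₇ b₁ b₂ b₃ b₄ =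
      villarrealMonomial x T a₁' a₂' a₃' a₄' a₅' a₆' a₇' b₁' b₂' b₃' b₄' := by
  induction n with
  | zero =>
    intro a₁ a₂ a₃ a₄ a₅ a₆ a₇ b₁ b₂ b₃ b₄
      a₁' a₂' a₃' a₄' a₅' a₆' a₇' b₁' b₂' b₃' b₄'
      h1 h2 h3 h4 h5 h6 h7 hb hn
    obtain ⟨rfl, rfl, rfl, rfl⟩ : b₁ = b₁' ∧ b₂ = b₂' ∧ b₃ = b₃' ∧ b₄ = b₄' := by
      clear h1 h2 h3 h4 h5 h6 h7
      omega
    clear hn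
    congr 1 <;> omega
  | succ n ih =>
    have step : ∀ {a₁ a₂ a₃ a₄ a₅ a₆ a₇ b₁ b₂ b₃ b₄
          a₁' a₂' a₃' a₄' a₅' a₆' a₇' b₁' b₂' b₃' b₄' : ℕ},
        a₁ + b₁ = a₁' + b₁' →
        a₂ + b₁ + b₂ = a₂' + b₁' + b₂' →
        a₃ + b₁ + b₄ = a₃' + b₁' + b₄' →
        a₄ + b₂ = a₄' + b₂' →
        a₅ + b₂ + b₃ = a₅' + b₂' + b₃' →
        a₆ + b₃ + b₄ = a₆' + b₃' + b₄' →
        a₇ + b₃ + b₄ = a₇' + b₃' + b₄' →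
        b₁ + b₂ + b₃ + b₄ = b₁' + b₂' + b₃' + b₄' →
        b₁' - b₁ + (b₂' - b₂) + (b₃' - b₃) + (b₄' - b₄) ≤ n + 1 →
        ((b₁ < b₁' ∧ b₂' < b₂ ∧ b₁ + b₄ < b₁' + b₄') ∨
          (b₂ < b₂' ∧ b₃' < b₃ ∧ b₁ + b₂ < b₁' + b₂') ∨
          (b₃ < b₃' ∧ b₄' < b₄ ∧ b₂ + b₃ < b₂' + b₃') ∨
          (b₄ < b₄' ∧ b₁' < b₁ ∧ b₃ + b₄ < b₃' + b₄') ∨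
          (b₁ < b₁' ∧ b₃' < b₃ ∧ b₁ + b₂ < b₁' + b₂' ∧ b₁ + b₄ < b₁' + b₄') ∨
          (b₂ < b₂' ∧ b₄' < b₄ ∧ b₁ + b₂ < b₁' + b₂' ∧ b₂ + b₃ < b₂' + b₃') ∨
          (b₁ < b₁' ∧ b₂' < b₂ ∧ b₃ < b₃' ∧ b₄' < b₄)) →
        villarrealMonomial x T a₁ a₂ a₃ a₄ a₅ a₆ a₇ b₁ b₂ b₃ b₄ =
          villarrealMonomial x T a₁' a₂' a₃' a₄' a₅' a₆' a₇' b₁' b₂' b₃' b₄' := by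
      intro a₁ a₂ a₃ a₄ a₅ a₆ a₇ b₁ b₂ b₃ b₄
        a₁' a₂' a₃' a₄' a₅' a₆' a₇' b₁' b₂' b₃' b₄'
        h1 h2 h3 h4 h5 h6 h7 hb hn hc
      rcases hc with hc | hc | hc | hc | hc | hc | hc
      · have hm := h.move_one_two (a₁ - 1) a₂ (a₃ - 1) a₄ a₅ a₆ a₇ b₁ (b₂ - 1) b₃ b₄
        rw [Nat.sub_add_cancel (show 1 ≤ a₁ by clear hn; omega),
          Nat.sub_add_cancel (show 1 ≤ a₃ by clear hn; omega),
          Nat.sub_add_cancel (show 1 ≤ b₂ by clear hn; omega)] at hm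
        refine hm.trans (ih ?_ ?_ ?_ ?_ ?_ ?_ ?_ ?_ ?_)
        on_goal 9 => clear h1 h2 h3 h4 h5 h6 h7
        on_goal 9 => omega
        all_goals clear hn; omega
      · have hm := h.move_two_three a₁ (a₂ - 1) a₃ (a₄ - 1) a₅ a₆ a₇ b₁ b₂ (b₃ - 1) b₄
        rw [Nat.sub_add_cancel (show 1 ≤ a₂ by clear hn; omega),
          Nat.sub_add_cancel (show 1 ≤ a₄ by clear hn; omega),
          Nat.sub_add_cancel (show 1 ≤ b₃ by clear hn; omega)] at hm
        refine hm.trans (ih ?_ ?_ ?_ ?_ ?_ ?_ ?_ ?_ ?_)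
        on_goal 9 => clear h1 h2 h3 h4 h5 h6 h7
        on_goal 9 => omega
        all_goals clear hn; omega
      · have hm := h.move_three_four a₁ a₂ a₃ a₄ (a₅ - 1) a₆ a₇ b₁ b₂ b₃ (b₄ - 1)
        rw [Nat.sub_add_cancel (show 1 ≤ a₅ by clear hn; omega),
          Nat.sub_add_cancel (show 1 ≤ b₄ by clear hn; omega)] at hm
        refine hm.trans (ih ?_ ?_ ?_ ?_ ?_ ?_ ?_ ?_ ?_)
        on_goal 9 => clear h1 h2 h3 h4 h5 h6 h7
        on_goal 9 => omega
        all_goals clear hn; omega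
      · have hm := h.move_four_one a₁ a₂ a₃ a₄ a₅ (a₆ - 1) (a₇ - 1) (b₁ - 1) b₂ b₃ b₄
        rw [Nat.sub_add_cancel (show 1 ≤ a₆ by clear hn; omega),
          Nat.sub_add_cancel (show 1 ≤ a₇ by clear hn; omega),
          Nat.sub_add_cancel (show 1 ≤ b₁ by clear hn; omega)] at hm
        refine hm.trans (ih ?_ ?_ ?_ ?_ ?_ ?_ ?_ ?_ ?_)
        on_goal 9 => clear h1 h2 h3 h4 h5 h6 h7
        on_goal 9 => omega
        all_goals clear hn; omega
      · have hm := h.move_one_three (a₁ - 1) (a₂ - 1) (a₃ - 1) a₄ a₅ a₆ a₇ b₁ b₂ (b₃ - 1) b₄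
        rw [Nat.sub_add_cancel (show 1 ≤ a₁ by clear hn; omega),
          Nat.sub_add_cancel (show 1 ≤ a₂ by clear hn; omega),
          Nat.sub_add_cancel (show 1 ≤ a₃ by clear hn; omega),
          Nat.sub_add_cancel (show 1 ≤ b₃ by clear hn; omega)] at hm
        refine hm.trans (ih ?_ ?_ ?_ ?_ ?_ ?_ ?_ ?_ ?_)
        on_goal 9 => clear h1 h2 h3 h4 h5 h6 h7
        on_goal 9 => omega
        all_goals clear hn; omega
      · have hm := h.move_two_four a₁ (a₂ - 1) a₃ (a₄ - 1) (a₅ - 1) a₆ a₇ b₁ b₂ b₃ (b₄ - 1)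
        rw [Nat.sub_add_cancel (show 1 ≤ a₂ by clear hn; omega),
          Nat.sub_add_cancel (show 1 ≤ a₄ by clear hn; omega),
          Nat.sub_add_cancel (show 1 ≤ a₅ by clear hn; omega),
          Nat.sub_add_cancel (show 1 ≤ b₄ by clear hn; omega)] at hm
        refine hm.trans (ih ?_ ?_ ?_ ?_ ?_ ?_ ?_ ?_ ?_)
        on_goal 9 => clear h1 h2 h3 h4 h5 h6 h7
        on_goal 9 => omega
        all_goals clear hn; omega
      · have hm := h.move_square (a₁ - 1) a₂ a₃ a₄ a₅ a₆ a₇ b₁ (b₂ - 1) b₃ (b₄ - 1)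
        rw [Nat.sub_add_cancel (show 1 ≤ a₁ by clear hn; omega),
          Nat.sub_add_cancel (show 1 ≤ b₂ by clear hn; omega),
          Nat.sub_add_cancel (show 1 ≤ b₄ by clear hn; omega)] at hm
        refine hm.trans (ih ?_ ?_ ?_ ?_ ?_ ?_ ?_ ?_ ?_)
        on_goal 9 => clear h1 h2 h3 h4 h5 h6 h7
        on_goal 9 => omega
        all_goals clear hn; omega
    intro a₁ a₂ a₃ a₄ a₅ a₆ a₇ b₁ b₂ b₃ b₄
      a₁' a₂' a₃' a₄' a₅' a₆' a₇' b₁' b₂' b₃' b₄'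
      h1 h2 h3 h4 h5 h6 h7 hb hn
    rcases exists_move hb with hc | hc | hc
    · clear hn step
      congr 1 <;> omega
    · exact step h1 h2 h3 h4 h5 h6 h7 hb hn hc
    · exact (step h1.symm h2.symm h3.symm h4.symm h5.symm h6.symm h7.symm hb.symm
        (by clear h1 h2 h3 h4 h5 h6 h7 hc; omega) hc).symm

end VillarrealRel

/-- The exponent vectors of the generators `f_1, …, f_4`. -/
noncomputable def villarrealExponent : Fin 4 → (Fin 7 →₀ ℕ) :=
  ![.single 0 1 + .single 1 1 + .single 2 1, .single 1 1 + .single 3 1 + .single 4 1,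
    .single 4 1 + .single 5 1 + .single 6 1, .single 2 1 + .single 5 1 + .single 6 1]

theorem villarrealGen_eq_monomial (k : Type*) [Field k] (i : Fin 4) :
    villarrealGen k i = monomial (villarrealExponent i) 1 := by
  fin_cases i <;> simp [villarrealGen, villarrealExponent, X, monomial_mul]

theorem villarrealPhi_monomial (k : Type*) [Field k] (a : Fin 7 →₀ ℕ) (b : Fin 4 →₀ ℕ) :
    villarrealPhi k (monomial b (monomial a 1)) =
      Polynomial.monomial (∑ i, b i) (monomial (a + ∑ i, b i • villarrealExponent i) 1) := by
  rw [villarrealPhi, aeval_monomial, Finsupp.prod_fintype _ _ fun i => pow_zero _]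
  simp only [mul_pow, Finset.prod_mul_distrib, Finset.prod_pow_eq_pow_sum, ← map_pow, ← map_prod,
    villarrealGen_eq_monomial, monomial_pow, one_pow]
  rw [← monomial_sum_one, Polynomial.algebraMap_eq, ← mul_assoc, ← map_mul, monomial_mul, one_mul,
    Polynomial.C_mul_X_pow_eq_monomial]

theorem monomial_monomial_eq_villarrealMonomial (k : Type*) [Field k]
    (a : Fin 7 →₀ ℕ) (b : Fin 4 →₀ ℕ) :
    (monomial b (monomial a 1) : MvPolynomial (Fin 4) (MvPolynomial (Fin 7) k)) =
      villarrealMonomial (fun i => C (X i)) X (a 0) (a 1) (a 2) (a 3) (a 4) (a 5) (a 6)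
        (b 0) (b 1) (b 2) (b 3) := by
  rw [monomial_eq, monomial_eq, Finsupp.prod_fintype _ _ fun i => pow_zero _,
    Finsupp.prod_fintype _ _ fun i => pow_zero _]
  simp [villarrealMonomial, Fin.prod_univ_succ, mul_assoc]

/-- An ideal modulo which the five relations hold contains the kernel of `φ`. -/
theorem ker_villarrealPhi_le (k : Type*) [Field k]
    (J : Ideal (MvPolynomial (Fin 4) (MvPolynomial (Fin 7) k)))
    (hrel : VillarrealRel (fun i => Ideal.Quotient.mk J (C (X i)))
      (fun i => Ideal.Quotient.mk J (X i))) :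
    RingHom.ker (villarrealPhi k) ≤ J := by
  intro f hf
  let B := (basisMonomials (Fin 7) k).smulTower (basisMonomials (Fin 4) (MvPolynomial (Fin 7) k))
  let D := (basisMonomials (Fin 7) k).smulTower (Polynomial.basisMonomials (MvPolynomial (Fin 7) k))
  have hB (a b) : B (a, b) = monomial b (monomial a 1) := by
    simp [B, Module.Basis.smulTower_apply, smul_monomial]
  have hD (a n) : D (a, n) = Polynomial.monomial n (monomial a 1) := by
    simp [D, Module.Basis.smulTower_apply, Polynomial.smul_monomial]
  refine LinearMap.ker_le_of_basis_of_sub_mem B D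
    (fun p => (p.1 + ∑ i, p.2 i • villarrealExponent i, ∑ i, p.2 i))
    ((villarrealPhi k).toLinearMap.restrictScalars k) ?_ (J.restrictScalars k) ?_ hf
  · rintro ⟨a, b⟩
    rw [hB, hD]
    exact villarrealPhi_monomial k a b
  · rintro ⟨a, b⟩ ⟨a', b'⟩ h
    rw [Prod.mk.injEq] at h
    obtain ⟨h, hb⟩ := h
    have hx := Fin.forall_fin_succ.1 fun j : Fin 7 => DFunLike.congr_fun h j
    simp [Fin.forall_fin_succ, Fin.sum_univ_four, villarrealExponent] at hx hb
    rw [Submodule.restrictScalars_mem, hB, hB, ← Ideal.Quotient.eq,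
      monomial_monomial_eq_villarrealMonomial, monomial_monomial_eq_villarrealMonomial]
    simp only [villarrealMonomial, map_mul, map_pow]
    exact hrel.monomial_eq _ (by omega) (by omega) (by omega) (by omega) (by omega) (by omega)
      (by omega) (by omega) le_rfl

/-- The defining ideal of the Rees algebra of
`I = (x_1x_2x_3, x_2x_4x_5, x_5x_6x_7, x_3x_6x_7)` is generated by the five binomials
`x_3T_3 − x_5T_4`, `x_6x_7T_1 − x_1x_2T_4`, `x_6x_7T_2 − x_2x_4T_3`,
`x_4x_5T_1 − x_1x_3T_2` and `x_4T_1T_3 − x_1T_2T_4`. -/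
theorem villarreal_example (k : Type*) [Field k] :
    RingHom.ker (villarrealPhi k) =
      Ideal.span {
        C (X 2 : MvPolynomial (Fin 7) k) * X 2 - C (X 4) * X 3,
        C ((X 5 : MvPolynomial (Fin 7) k) * X 6) * X 0 - C (X 0 * X 1) * X 3,
        C ((X 5 : MvPolynomial (Fin 7) k) * X 6) * X 1 - C (X 1 * X 3) * X 2,
        C ((X 3 : MvPolynomial (Fin 7) k) * X 4) * X 0 - C (X 0 * X 2) * X 1,
        C (X 3 : MvPolynomial (Fin 7) k) * (X 0 * X 2) - C (X 0) * (X 1 * X 3) } := by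
  refine le_antisymm ?_ ?_
  · refine ker_villarrealPhi_le k _ ⟨?_, ?_, ?_, ?_, ?_⟩ <;>
      simp only [← map_mul] <;>
      refine Ideal.Quotient.eq.2 (Ideal.subset_span ?_) <;>
      simp
  · rw [Ideal.span_le]
    rintro p (rfl | rfl | rfl | rfl | rfl) <;>
      simp [villarrealPhi, villarrealGen, RingHom.mem_ker] <;> ring
end
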